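/- arXiv:1609.08481 — 3 statements merged into one kernel-verified Lean document; each statement's English description precedes it below -/
import Mathlib

section
/- Let x = [g] ∈ ℒ_n where g ∈ SL_n(ℝ) is in upper triangular block form with diagonal blocks g₁,…,g_k, g_i ∈ SL_{n_i}(ℝ), n = n₁+⋯+n_k (all entries below the diagonal blocks are zero). If for each 1 ≤ i ≤ k the lattice [g_i] ∈ ℒ_{n_i} is stable, then x is stable. -/
open scoped BigOperators
open Matrix Topology Filter

noncomputable section

namespace SW

/-! ### Euclidean structure on `Fin n → ℝ` -/

/-- The standard Euclidean inner product on `Fin n → ℝ`. -/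
def einner {n : ℕ} (v w : Fin n → ℝ) : ℝ := ∑ i, v i * w i

/-- The Euclidean norm on `Fin n → ℝ`. -/
def enorm {n : ℕ} (v : Fin n → ℝ) : ℝ := Real.sqrt (∑ i, v i ^ 2)

lemma einner_add_left {n : ℕ} (u v w : Fin n → ℝ) :
    einner (u + v) w = einner u w + einner v w := by
  simp [einner, add_mul, Finset.sum_add_distrib]

lemma einner_neg_left {n : ℕ} (u w : Fin n → ℝ) : einner (-u) w = -einner u w := by
  simp [einner]

lemma einner_smul_left {n : ℕ} (c : ℝ) (u w : Fin n → ℝ) :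
    einner (c • u) w = c * einner u w := by
  simp [einner, Finset.mul_sum, mul_assoc]

/-! ### Covolume, rank, lattices, stability -/

/-- `√(det Gram)` of a finite family of vectors: the covolume of the ℤ-span of the family
(in the span of the family) when the family is linearly independent. -/
def gvol {n r : ℕ} (v : Fin r → (Fin n → ℝ)) : ℝ :=
  Real.sqrt (Matrix.det (Matrix.of fun i j => einner (v i) (v j)))

/-- `c` is the covolume of `Λ` in its real span, as computed from some ℤ-basis of `Λ` which is
linearly independent over `ℝ`. -/
def covolSpec {n : ℕ} (Λ : AddSubgroup (Fin n → ℝ)) (c : ℝ) : Prop :=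
  ∃ (r : ℕ) (v : Fin r → (Fin n → ℝ)), LinearIndependent ℝ v ∧
    Λ = AddSubgroup.closure (Set.range v) ∧ c = gvol v

/-- The covolume of a discrete subgroup `Λ ⊆ ℝⁿ` inside its real span (with `covol ⊥ = 1`). -/
def covol {n : ℕ} (Λ : AddSubgroup (Fin n → ℝ)) : ℝ := sInf {c | covolSpec Λ c}

/-- The rank of a discrete subgroup of `ℝⁿ`: the dimension of its real span. -/
def rk {n : ℕ} (Λ : AddSubgroup (Fin n → ℝ)) : ℕ :=
  Module.finrank ℝ (Submodule.span ℝ (Λ : Set (Fin n → ℝ)))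

/-- A lattice in `ℝⁿ`: a discrete subgroup spanning `ℝⁿ` (equivalently, cocompact). -/
def IsLattice {n : ℕ} (L : AddSubgroup (Fin n → ℝ)) : Prop :=
  DiscreteTopology ↥L ∧ Submodule.span ℝ (L : Set (Fin n → ℝ)) = ⊤

/-- A unimodular lattice: a lattice of covolume one. -/
def IsUnimodularLattice {n : ℕ} (L : AddSubgroup (Fin n → ℝ)) : Prop :=
  IsLattice L ∧ covol L = 1

/-- A stable lattice: a unimodular lattice all of whose subgroups have covolume at least one. -/
def IsStable {n : ℕ} (L : AddSubgroup (Fin n → ℝ)) : Prop :=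
  IsUnimodularLattice L ∧ ∀ Λ : AddSubgroup (Fin n → ℝ), Λ ≤ L → 1 ≤ covol Λ

/-! ### Matrices: the diagonal group `A`, `SL_n(ℤ)`, lattices from matrices -/

/-- The group `A` of positive diagonal matrices of determinant one (as a set of matrices). -/
def Apos (n : ℕ) : Set (Matrix (Fin n) (Fin n) ℝ) :=
  {a | ∃ d : Fin n → ℝ, (∀ i, 0 < d i) ∧ (∏ i, d i) = 1 ∧ a = Matrix.diagonal d}

/-- `SL_n(ℤ)` viewed as a set of real matrices. -/
def Gam (n : ℕ) : Set (Matrix (Fin n) (Fin n) ℝ) :=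
  {γ | γ.det = 1 ∧ ∀ i j, ∃ m : ℤ, γ i j = (m : ℝ)}

/-- The lattice `g·ℤⁿ` associated to a matrix `g`. -/
def latticeOf {n : ℕ} (g : Matrix (Fin n) (Fin n) ℝ) : AddSubgroup (Fin n → ℝ) :=
  AddSubgroup.closure (Set.range fun m : Fin n → ℤ => g.mulVec fun i => (m i : ℝ))

/-- The image `g·L` of a lattice under a matrix. -/
def mapLat {n : ℕ} (g : Matrix (Fin n) (Fin n) ℝ) (L : AddSubgroup (Fin n → ℝ)) :
    AddSubgroup (Fin n → ℝ) :=
  AddSubgroup.map (Matrix.mulVecLin g).toAddMonoidHom L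

/-- The full preimage `A·g·Γ` in `SL_n(ℝ)` of the orbit `A·[g] ⊆ ℒ_n`; a point `[h] ∈ ℒ_n`
lies in the closure of `A·[g]` iff `h ∈ closure (AOrbit g)`. -/
def AOrbit {n : ℕ} (g : Matrix (Fin n) (Fin n) ℝ) : Set (Matrix (Fin n) (Fin n) ℝ) :=
  {p | ∃ a ∈ Apos n, ∃ γ ∈ Gam n, p = a * g * γ}

/-- The orbit `A·[g] ⊆ ℒ_n` is bounded (has compact closure). -/
def HasBoundedAOrbit {n : ℕ} (g : Matrix (Fin n) (Fin n) ℝ) : Prop :=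
  ∃ K : Set (Matrix (Fin n) (Fin n) ℝ), IsCompact K ∧
    ∀ a ∈ Apos n, ∃ γ ∈ Gam n, a * g * γ ∈ K

/-! ### `α`, `Min_δ`, `V_δ`, `dim_δ` -/

/-- `α(x) = min { |Λ|^{1/r(Λ)} : Λ a nonzero subgroup of x }`. -/
def alpha {n : ℕ} (x : AddSubgroup (Fin n → ℝ)) : ℝ :=
  sInf {c | ∃ Λ : AddSubgroup (Fin n → ℝ), Λ ≤ x ∧ Λ ≠ ⊥ ∧ c = covol Λ ^ ((rk Λ : ℝ)⁻¹)}

/-- `α_k(x) = min { |Λ|^{1/k} : Λ a rank-`k` subgroup of x }`. -/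
def alphak {n : ℕ} (k : ℕ) (x : AddSubgroup (Fin n → ℝ)) : ℝ :=
  sInf {c | ∃ Λ : AddSubgroup (Fin n → ℝ), Λ ≤ x ∧ rk Λ = k ∧ c = covol Λ ^ ((k : ℝ)⁻¹)}

/-- `Min_δ(x)`: nonzero subgroups nearly attaining `α(x)`. -/
def MinSet {n : ℕ} (δ : ℝ) (x : AddSubgroup (Fin n → ℝ)) : Set (AddSubgroup (Fin n → ℝ)) :=
  {Λ | Λ ≤ x ∧ Λ ≠ ⊥ ∧ covol Λ ^ ((rk Λ : ℝ)⁻¹) < (1 + δ) * alpha x}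

/-- `V_δ(x)`: the span of the subgroups in `Min_δ(x)`. -/
def Vdelta {n : ℕ} (δ : ℝ) (x : AddSubgroup (Fin n → ℝ)) : Submodule ℝ (Fin n → ℝ) :=
  Submodule.span ℝ (⋃ Λ ∈ MinSet δ x, (Λ : Set (Fin n → ℝ)))

/-- `dim_δ(x) = dim V_δ(x)`. -/
def dimdelta {n : ℕ} (δ : ℝ) (x : AddSubgroup (Fin n → ℝ)) : ℕ :=
  Module.finrank ℝ (Vdelta δ x)

/-- `U_k^{x,ε} ⊆ A`: those `a` for which `δ ↦ dim_δ(ax)` equals `k` near `kε`. -/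
def Uset {n : ℕ} (x : AddSubgroup (Fin n → ℝ)) (ε : ℝ) (k : ℕ) :
    Set (Matrix (Fin n) (Fin n) ℝ) :=
  {a | a ∈ Apos n ∧ ∃ s ∈ 𝓝 ((k : ℝ) * ε), ∀ δ ∈ s, dimdelta δ (mapLat a x) = k}

/-- Logarithmic coordinates on the diagonal group. -/
def logCoord {n : ℕ} (a : Matrix (Fin n) (Fin n) ℝ) : Fin n → ℝ := fun i => Real.log (a i i)

/-! ### Covering radius -/

/-- The covering radius `covrad(L) = sup_u inf_{v ∈ L} ‖u - v‖`. -/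
def covrad {n : ℕ} (L : AddSubgroup (Fin n → ℝ)) : ℝ :=
  ⨆ u : Fin n → ℝ, ⨅ v : L, enorm (u - (v : Fin n → ℝ))

/-- `[g]` is a local maximum of `covrad : ℒ_d → ℝ` (phrased via the open quotient
`SL_d(ℝ) → ℒ_d`). -/
def IsLocalMaxCovrad {d : ℕ} (g : Matrix (Fin d) (Fin d) ℝ) : Prop :=
  ∃ W ∈ 𝓝 g, ∀ g' ∈ W, Matrix.det g' = 1 → covrad (latticeOf g') ≤ covrad (latticeOf g)

/-! ### Block upper triangular form -/

/-- Offset of the `i`-th diagonal block. -/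
def off {k : ℕ} (ns : Fin k → ℕ) (i : Fin k) : ℕ :=
  ∑ j ∈ Finset.univ.filter (fun j => j < i), ns j

lemma off_add_lt {k : ℕ} (ns : Fin k → ℕ) (i : Fin k) (a : Fin (ns i)) :
    off ns i + (a : ℕ) < ∑ j, ns j := by
  unfold off
  have hins : i ∉ Finset.univ.filter (fun j => j < i) := by simp
  have h2 : ∑ j ∈ insert i (Finset.univ.filter (fun j => j < i)), ns j ≤ ∑ j, ns j :=
    Finset.sum_le_sum_of_subset (Finset.subset_univ _)
  rw [Finset.sum_insert hins] at h2
  have := a.isLt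
  omega

/-- The position, in `Fin n`, of the `a`-th coordinate of the `i`-th block. -/
def blockEmb {n k : ℕ} (ns : Fin k → ℕ) (hsum : (∑ j, ns j) = n) (i : Fin k)
    (a : Fin (ns i)) : Fin n :=
  ⟨off ns i + (a : ℕ), hsum ▸ off_add_lt ns i a⟩

/-- `g` is block upper triangular with diagonal blocks `G i` (block sizes `ns`). -/
def IsBlockUT {n k : ℕ} (ns : Fin k → ℕ) (hsum : (∑ j, ns j) = n)
    (g : Matrix (Fin n) (Fin n) ℝ) (G : ∀ i, Matrix (Fin (ns i)) (Fin (ns i)) ℝ) : Prop :=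
  (∀ (i : Fin k) (a b : Fin (ns i)),
      g (blockEmb ns hsum i a) (blockEmb ns hsum i b) = G i a b) ∧
  (∀ (i j : Fin k) (a : Fin (ns i)) (b : Fin (ns j)), j < i →
      g (blockEmb ns hsum i a) (blockEmb ns hsum j b) = 0)

/-! ### Mordell constant -/

/-- The symmetric box `[-a₁,a₁] × ⋯ × [-aₙ,aₙ]` is admissible for `L`: its interior contains
no nonzero point of `L`. -/
def IsAdmissibleBox {n : ℕ} (L : AddSubgroup (Fin n → ℝ)) (a : Fin n → ℝ) : Prop :=
  (∀ i, 0 < a i) ∧ ∀ v ∈ L, v ≠ 0 → ∃ i, a i ≤ |v i|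

/-- The Mordell constant `κ(L) = 2⁻ⁿ sup { Vol(B) : B admissible symmetric box for L }`. -/
def mordellConst {n : ℕ} (L : AddSubgroup (Fin n → ℝ)) : ℝ :=
  (1 / 2 ^ n) * sSup {V | ∃ a : Fin n → ℝ, IsAdmissibleBox L a ∧ V = ∏ i, 2 * a i}

/-! ### Hermite constant -/

/-- Length of a shortest nonzero vector of `L`. -/
def shortest {m : ℕ} (L : AddSubgroup (Fin m → ℝ)) : ℝ :=
  sInf {t | ∃ w ∈ L, w ≠ 0 ∧ t = enorm w}

/-- The Hermite constant `γ_m`. -/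
def hermiteConst (m : ℕ) : ℝ :=
  sSup {c | ∃ L : AddSubgroup (Fin m → ℝ), IsUnimodularLattice L ∧ c = shortest L ^ 2}

/-! ### Korkine–Zolotarev reduction -/

/-- `v 0, …, v (n-1)` is a Korkine–Zolotarev reduced basis of `x`: it is a ℤ-basis, and for
each `i` the orthogonal projection of `v i` onto `span(v 0, …, v (i-1))^⊥` is shortest among the
nonzero such projections of vectors of `x` (projection lengths are expressed through Gram
determinants: the projection of `w` has length `gvol (v 0, …, v (i-1), w) / gvol (v 0, …, v (i-1))`). -/
def IsKZBasis {n : ℕ} (x : AddSubgroup (Fin n → ℝ)) (v : ℕ → (Fin n → ℝ)) : Prop :=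
  LinearIndependent ℝ (fun j : Fin n => v (j : ℕ)) ∧
  x = AddSubgroup.closure (v '' Set.Iio n) ∧
  ∀ i < n, ∀ w ∈ x, w ∉ Submodule.span ℝ (v '' Set.Iio i) →
    gvol (Fin.snoc (fun j : Fin i => v (j : ℕ)) (v i)) ≤
      gvol (Fin.snoc (fun j : Fin i => v (j : ℕ)) w)

/-- `A 0, …, A (n-1)` are the diagonal Korkine–Zolotarev coefficients of `x`: the lengths of
the successive orthogonal projections in a KZ reduced basis, i.e.
`A i = gvol (v 0, …, v i) / gvol (v 0, …, v (i-1))`. -/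
def HasKZCoeffs {n : ℕ} (x : AddSubgroup (Fin n → ℝ)) (A : ℕ → ℝ) : Prop :=
  ∃ v : ℕ → (Fin n → ℝ), IsKZBasis x v ∧
    ∀ i < n, A i * gvol (fun j : Fin i => v (j : ℕ)) = gvol (fun j : Fin (i + 1) => v (j : ℕ))

/-! ### Orthogonal complements and projections of lattices -/

/-- The orthogonal complement of a subspace `V ⊆ ℝⁿ`. -/
def orthoC {n : ℕ} (V : Submodule ℝ (Fin n → ℝ)) : Submodule ℝ (Fin n → ℝ) where
  carrier := {w | ∀ v ∈ V, einner w v = 0}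
  zero_mem' := by intro v hv; simp [einner]
  add_mem' := by intro a b ha hb v hv; rw [einner_add_left, ha v hv, hb v hv, add_zero]
  smul_mem' := by intro c w hw v hv; rw [einner_smul_left, hw v hv, mul_zero]

/-- The image `π(x)` of `x` under the orthogonal projection `π : ℝⁿ → V^⊥`:
`p = π(u)` iff `p ⊥ V` and `u - p ∈ V`. -/
def projLat {n : ℕ} (V : Submodule ℝ (Fin n → ℝ)) (x : AddSubgroup (Fin n → ℝ)) :
    AddSubgroup (Fin n → ℝ) where
  carrier := {p | (∀ v ∈ V, einner p v = 0) ∧ ∃ u ∈ x, u - p ∈ V}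
  zero_mem' := ⟨by intro v hv; simp [einner], 0, x.zero_mem, by rw [sub_zero]; exact V.zero_mem⟩
  add_mem' := by
    rintro p q ⟨hp1, u1, hu1, hp2⟩ ⟨hq1, u2, hu2, hq2⟩
    refine ⟨fun v hv => by rw [einner_add_left, hp1 v hv, hq1 v hv, add_zero],
      u1 + u2, x.add_mem hu1 hu2, ?_⟩
    have h : u1 + u2 - (p + q) = u1 - p + (u2 - q) := by abel
    rw [h]; exact V.add_mem hp2 hq2
  neg_mem' := by
    rintro p ⟨hp1, u, hu, hp2⟩
    refine ⟨fun v hv => by rw [einner_neg_left, hp1 v hv, neg_zero],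
      -u, x.neg_mem hu, ?_⟩
    have h : -u - -p = -(u - p) := by abel
    rw [h]; exact V.neg_mem hp2

end SW

namespace SW

/-- Adding a rank-one positive semidefinite matrix does not decrease the determinant. -/
lemma det_le_det_add_vecMulVec {ι : Type*} [Fintype ι] [DecidableEq ι] {A : Matrix ι ι ℝ}
    (hA : A.PosDef) (v : ι → ℝ) : A.det ≤ (A + vecMulVec v (star v)).det := by
  rw [vecMulVec_eq Unit, det_add_replicateCol_mul_replicateRow (ι := Unit) hA.det_pos.ne'.isUnit,
    det_unique (n := Unit)]
  refine le_mul_of_one_le_right hA.det_pos.le ?_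
  have h := hA.inv.posSemidef.dotProduct_mulVec_nonneg v
  rw [Matrix.mul_assoc, Matrix.add_apply, one_apply_eq, ← replicateCol_mulVec]
  simpa using h

lemma det_le_det_add {ι : Type*} [Fintype ι] [DecidableEq ι] {A B : Matrix ι ι ℝ}
    (hA : A.PosDef) (hB : B.PosSemidef) : A.det ≤ (A + B).det := by
  obtain ⟨m, v, rfl⟩ := posSemidef_iff_eq_sum_vecMulVec.mp hB
  clear hB
  induction m with
  | zero => simp
  | succ m ih =>
    rw [Fin.sum_univ_castSucc, ← add_assoc]
    refine (ih fun i => v i.castSucc).trans (det_le_det_add_vecMulVec ?_ _)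
    exact hA.add_posSemidef (posSemidef_sum _ fun i _ => posSemidef_vecMulVec_self_star _)

/-- The Gram matrix of a family of vectors of `ℝⁿ`. -/
def gramMat {ι : Type*} {n : ℕ} (v : ι → Fin n → ℝ) : Matrix ι ι ℝ :=
  Matrix.of v * (Matrix.of v)ᵀ

lemma gvol_eq {n r : ℕ} (v : Fin r → Fin n → ℝ) : gvol v = Real.sqrt (gramMat v).det := rfl

lemma posSemidef_gramMat {ι : Type*} [Fintype ι] {n : ℕ} (v : ι → Fin n → ℝ) :
    (gramMat v).PosSemidef := posSemidef_self_mul_conjTranspose (Matrix.of v)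

lemma posDef_gramMat {ι : Type*} [Fintype ι] {n : ℕ} {v : ι → Fin n → ℝ}
    (hv : LinearIndependent ℝ v) : (gramMat v).PosDef :=
  PosDef.mul_conjTranspose_self (Matrix.of v) (vecMul_injective_iff.mpr hv)

lemma gramMat_sumElim {ι κ : Type*} {n : ℕ} (w : ι → Fin n → ℝ) (u : κ → Fin n → ℝ) :
    gramMat (Sum.elim w u) = fromBlocks (gramMat w) (Matrix.of w * (Matrix.of u)ᵀ)
      (Matrix.of w * (Matrix.of u)ᵀ)ᴴ (gramMat u) := by
  ext (i | i) (j | j) <;> simp [gramMat, mul_apply, mul_comm]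

/-- The Gram determinant is at least the product of that of the vectors killed by a coordinate
projection and that of the projections of the remaining vectors. -/
lemma det_gramMat_mul_le {ι κ : Type*} [Fintype ι] [Fintype κ] [DecidableEq ι] [DecidableEq κ]
    {n p : ℕ} {e : Fin p → Fin n} (he : Function.Injective e)
    {w : ι → Fin n → ℝ} {u : κ → Fin n → ℝ} (hw : LinearIndependent ℝ w)
    (hwe : ∀ i, w i ∘ e = 0) (hu : LinearIndependent ℝ fun j => u j ∘ e) :
    (gramMat w).det * (gramMat fun j => u j ∘ e).det ≤ (gramMat (Sum.elim w u)).det := by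
  have hW := posDef_gramMat hw
  let _ := hW.isUnit.invertible
  let u' : κ → Fin n → ℝ := fun j i => if i ∈ Set.range e then 0 else u j i
  have hsplit : gramMat u = gramMat u' + gramMat fun j => u j ∘ e := by
    ext i j
    have : ∑ a, u i (e a) * u j (e a) = ∑ b, if b ∈ Set.range e then u i b * u j b else 0 := by
      rw [← Finset.sum_filter]
      rw [← Finset.sum_image (f := fun b => u i b * u j b) (s := Finset.univ) (g := e) he.injOn]
      congr 1
      ext; simp
    simp only [gramMat, mul_apply, Matrix.add_apply, of_apply, transpose_apply,
      Function.comp_apply, this, ← Finset.sum_add_distrib, u']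
    refine Finset.sum_congr rfl fun b _ => ?_
    split_ifs <;> simp
  have hC : Matrix.of w * (Matrix.of u')ᵀ = Matrix.of w * (Matrix.of u)ᵀ := by
    ext i j
    simp only [mul_apply, of_apply, transpose_apply, u']
    refine Finset.sum_congr rfl fun b _ => ?_
    split_ifs with h
    · obtain ⟨a, rfl⟩ := h
      have := congrFun (hwe i) a
      simp_all
    · rfl
  have hS := posSemidef_gramMat (Sum.elim w u')
  rw [gramMat_sumElim, hC, PosDef.fromBlocks₁₁ _ _ hW] at hS
  rw [gramMat_sumElim, det_fromBlocks₁₁, invOf_eq_nonsing_inv]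
  refine mul_le_mul_of_nonneg_left ?_ hW.det_pos.le
  rw [hsplit, add_sub_right_comm, add_comm]
  exact det_le_det_add (posDef_gramMat hu) hS

/-- Integer-independent vectors generating a discrete subgroup are linearly independent. -/
lemma linearIndependent_real_of_discrete {ι E : Type*} [Fintype ι] [NormedAddCommGroup E]
    [NormedSpace ℝ E] [FiniteDimensional ℝ E] {L : AddSubgroup E} (hL : DiscreteTopology L)
    {v : ι → E} (hvL : ∀ i, v i ∈ L) (hv : LinearIndependent ℤ v) : LinearIndependent ℝ v := by
  have hd : DiscreteTopology (Submodule.span ℤ (Set.range v)) := by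
    refine DiscreteTopology.of_subset (s := (L : Set E)) hL ?_
    have : Submodule.span ℤ (Set.range v) ≤ AddSubgroup.toIntSubmodule L :=
      Submodule.span_le.mpr (Set.range_subset_iff.mpr hvL)
    exact this
  rw [linearIndependent_iff_card_eq_finrank_span, Real.finrank_eq_int_finrank_of_discrete hd]
  exact linearIndependent_iff_card_eq_finrank_span.mp hv

/-- Two integral bases of the same subgroup: real independence and the Gram determinant do not
depend on the basis. -/
lemma gramMat_basis {ι κ : Type*} [Fintype ι] [Fintype κ] [DecidableEq ι] [DecidableEq κ]
    {n : ℕ} {M : Submodule ℤ (Fin n → ℝ)} (b : Module.Basis ι ℤ M) (c : Module.Basis κ ℤ M)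
    (hb : LinearIndependent ℝ fun i => (b i : Fin n → ℝ)) :
    LinearIndependent ℝ (fun i => (c i : Fin n → ℝ)) ∧
      (gramMat fun i => (c i : Fin n → ℝ)).det = (gramMat fun i => (b i : Fin n → ℝ)).det := by
  let P : Matrix κ ι ℝ := (b.toMatrix c)ᵀ.map (Int.castRingHom ℝ)
  let Q : Matrix ι κ ℝ := (c.toMatrix b)ᵀ.map (Int.castRingHom ℝ)
  have hPQ : P * Q = 1 := by
    simp only [P, Q]
    rw [← Matrix.map_mul, ← transpose_mul, c.toMatrix_mul_toMatrix_flip]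
    simp
  have hQP : Q * P = 1 := by
    simp only [P, Q]
    rw [← Matrix.map_mul, ← transpose_mul, b.toMatrix_mul_toMatrix_flip]
    simp
  have hc : Matrix.of (fun i => (c i : Fin n → ℝ)) = P * Matrix.of fun i => (b i : Fin n → ℝ) := by
    ext i a
    have h := congrArg (fun x : M => (x : Fin n → ℝ) a) (b.sum_toMatrix_smul_self c i)
    simp only [Submodule.coe_sum, Submodule.coe_smul, Finset.sum_apply, zsmul_eq_mul] at h
    simp only [mul_apply, P, map_apply, transpose_apply, of_apply, ← h, eq_intCast]
    rfl
  refine ⟨?_, ?_⟩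
  · have hinj := vecMul_injective_iff.mpr hb
    refine vecMul_injective_iff (M := Matrix.of fun i => (c i : Fin n → ℝ)).mp fun x y hxy => ?_
    simp only [hc, ← vecMul_vecMul] at hxy
    have := congrArg (· ᵥ* Q) (hinj hxy)
    simpa [hPQ] using this
  · have hunit : IsUnit (b.toMatrix c * (b.toMatrix c)ᵀ).det := by
      refine IsUnit.of_mul_eq_one ((c.toMatrix b)ᵀ * c.toMatrix b).det ?_
      rw [← det_mul, Matrix.mul_assoc, ← Matrix.mul_assoc _ (c.toMatrix b)ᵀ, ← transpose_mul,
        c.toMatrix_mul_toMatrix_flip, transpose_one, Matrix.one_mul, b.toMatrix_mul_toMatrix_flip,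
        det_one]
    have hPP : (Pᵀ * P).det = 1 := by
      have hcast : Pᵀ * P = (b.toMatrix c * (b.toMatrix c)ᵀ).map (Int.castRingHom ℝ) := by
        rw [Matrix.map_mul]; rfl
      have hnonneg : 0 ≤ (Pᵀ * P).det := (posSemidef_conjTranspose_mul_self P).det_nonneg
      rw [hcast, ← RingHom.mapMatrix_apply, ← RingHom.map_det] at hnonneg ⊢
      rcases Int.isUnit_iff.mp hunit with h | h <;> simp [h] at hnonneg ⊢
      linarith
    rw [gramMat, hc, transpose_mul, Matrix.mul_assoc, det_comm' hPQ hQP, Matrix.mul_assoc,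
      Matrix.mul_assoc, ← Matrix.mul_assoc, det_mul, hPP, mul_one]
    rfl

/-- Every linearly independent family of vectors of `L` has Gram determinant at least one. -/
def GramBounded {n : ℕ} (L : AddSubgroup (Fin n → ℝ)) : Prop :=
  ∀ (r : ℕ) (v : Fin r → Fin n → ℝ), LinearIndependent ℝ v → (∀ i, v i ∈ L) →
    1 ≤ (gramMat v).det

lemma GramBounded.one_le_det {n : ℕ} {L : AddSubgroup (Fin n → ℝ)} (hL : GramBounded L)
    {ι : Type*} [Fintype ι] [DecidableEq ι] {v : ι → Fin n → ℝ} (hv : LinearIndependent ℝ v)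
    (hvL : ∀ i, v i ∈ L) : 1 ≤ (gramMat v).det := by
  let e := Fintype.equivFin ι
  have h := hL _ (v ∘ e.symm) (hv.comp _ e.symm.injective) fun i => hvL _
  have heq : gramMat (v ∘ e.symm) = (gramMat v).submatrix e.symm e.symm := rfl
  rwa [heq, det_submatrix_equiv_self] at h

lemma GramBounded.of_extension {n p : ℕ} {L L' : AddSubgroup (Fin n → ℝ)}
    {L'' : AddSubgroup (Fin p → ℝ)} {e : Fin p → Fin n} (he : Function.Injective e)
    (hproj : ∀ x ∈ L, x ∘ e ∈ L'') (hker : ∀ x ∈ L, x ∘ e = 0 → x ∈ L')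
    (hdisc : DiscreteTopology L'') (h' : GramBounded L') (h'' : GramBounded L'') :
    GramBounded L := by
  intro r v hv hvL
  let M := Submodule.span ℤ (Set.range v)
  have hML : M ≤ AddSubgroup.toIntSubmodule L :=
    Submodule.span_le.mpr (Set.range_subset_iff.mpr hvL)
  have hvZ : LinearIndependent ℤ v := hv.restrict_scalars' ℤ
  let b : Module.Basis (Fin r) ℤ M := Module.Basis.span hvZ
  have hb : ∀ i, (b i : Fin n → ℝ) = v i := fun i =>
    congrArg Subtype.val (Module.Basis.span_apply hvZ i)
  have : Module.Finite ℤ M := Module.Finite.of_basis b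
  have : Module.Free ℤ M := Module.Free.of_basis b
  let φ : M →ₗ[ℤ] (Fin p → ℝ) := LinearMap.funLeft ℤ ℝ e ∘ₗ M.subtype
  have hφ : ∀ x : M, φ x = (x : Fin n → ℝ) ∘ e := fun _ => rfl
  have : Module.Free ℤ (LinearMap.range φ) := inferInstance
  have : Module.Free ℤ (M ⧸ LinearMap.ker φ) := Module.Free.of_equiv φ.quotKerEquivRange.symm
  let bK := Module.finBasis ℤ (LinearMap.ker φ)
  let bQ := Module.finBasis ℤ (M ⧸ LinearMap.ker φ)
  let c := Module.Basis.sumQuot bK bQ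
  obtain ⟨hcli, hcdet⟩ := gramMat_basis b c (by simpa only [hb] using hv)
  simp only [hb] at hcdet
  let w : Fin _ → Fin n → ℝ := fun i => c (Sum.inl i)
  let u : Fin _ → Fin n → ℝ := fun j => c (Sum.inr j)
  have hwu : (fun i => (c i : Fin n → ℝ)) = Sum.elim w u := by
    ext (i | i) <;> rfl
  rw [hwu] at hcli hcdet
  have hw : LinearIndependent ℝ w := hcli.comp Sum.inl Sum.inl_injective
  have hwe : ∀ i, w i ∘ e = 0 := fun i => by
    have : φ (bK i) = 0 := (bK i).2
    simpa only [w, c, Module.Basis.sumQuot_inl, hφ] using this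
  have hue : ∀ j, u j ∘ e ∈ L'' := fun j => hproj _ (hML (c (Sum.inr j)).2)
  have hu : LinearIndependent ℤ fun j => u j ∘ e := by
    have h := bQ.linearIndependent.map' (φ.quotKerEquivRange.toLinearMap) φ.quotKerEquivRange.ker
    have h := h.map' (LinearMap.range φ).subtype (Submodule.ker_subtype _)
    have heq : (fun j => u j ∘ e) =
        (LinearMap.range φ).subtype ∘ φ.quotKerEquivRange.toLinearMap ∘ bQ := by
      ext j : 1
      simp only [Function.comp_apply, ← Module.Basis.sumQuot_inr bK bQ j]
      rfl
    rw [heq]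
    exact h
  have hu' := linearIndependent_real_of_discrete hdisc hue hu
  rw [← hcdet]
  refine le_trans ?_ (det_gramMat_mul_le he hw hwe hu')
  exact one_le_mul_of_one_le_of_one_le
    (h'.one_le_det hw fun i => hker _ (hML (c (Sum.inl i)).2) (hwe i)) (h''.one_le_det hu' hue)

lemma covol_le_gvol {n r : ℕ} {v : Fin r → Fin n → ℝ} (hv : LinearIndependent ℝ v) :
    covol (AddSubgroup.closure (Set.range v)) ≤ gvol v := by
  refine csInf_le ⟨0, ?_⟩ ⟨r, v, hv, rfl, rfl⟩
  rintro _ ⟨_, _, _, _, rfl⟩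
  exact Real.sqrt_nonneg _

lemma IsStable.gramBounded {n : ℕ} {L : AddSubgroup (Fin n → ℝ)} (hL : IsStable L) :
    GramBounded L := by
  intro r v hv hvL
  have h : 1 ≤ gvol v :=
    (hL.2 _ ((AddSubgroup.closure_le L).mpr (Set.range_subset_iff.mpr hvL))).trans (covol_le_gvol hv)
  rwa [gvol_eq, Real.one_le_sqrt] at h

/-- A discrete subgroup has a finite ℤ-basis that is linearly independent over `ℝ`. -/
lemma exists_covolSpec {n : ℕ} {L : AddSubgroup (Fin n → ℝ)} (hL : DiscreteTopology L) :
    ∃ c, covolSpec L c := by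
  have : DiscreteTopology (AddSubgroup.toIntSubmodule L) := hL
  let b := Module.finBasis ℤ (AddSubgroup.toIntSubmodule L)
  let v : Fin _ → Fin n → ℝ := fun i => b i
  have hvZ : LinearIndependent ℤ v :=
    b.linearIndependent.map' (AddSubgroup.toIntSubmodule L).subtype (Submodule.ker_subtype _)
  refine ⟨gvol v, _, v, linearIndependent_real_of_discrete hL (fun i => (b i).2) hvZ, ?_, rfl⟩
  have hspan : Submodule.span ℤ (Set.range v) = AddSubgroup.toIntSubmodule L := by
    have := congrArg (Submodule.map (AddSubgroup.toIntSubmodule L).subtype) b.span_eq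
    rw [Submodule.map_span, ← Set.range_comp, Submodule.map_top, Submodule.range_subtype] at this
    exact this
  rw [← Submodule.span_int_eq_addSubgroupClosure, hspan]
  rfl

lemma GramBounded.one_le_covol {n : ℕ} {L Λ : AddSubgroup (Fin n → ℝ)} (hL : GramBounded L)
    (hdisc : DiscreteTopology L) (hΛ : Λ ≤ L) : 1 ≤ covol Λ := by
  refine le_csInf (exists_covolSpec (DiscreteTopology.of_subset hdisc hΛ)) ?_
  rintro _ ⟨r, v, hv, rfl, rfl⟩
  rw [gvol_eq, Real.one_le_sqrt]
  exact hL r v hv fun i => hΛ (AddSubgroup.subset_closure (Set.mem_range_self i))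

lemma mem_latticeOf {n : ℕ} {g : Matrix (Fin n) (Fin n) ℝ} {x : Fin n → ℝ} :
    x ∈ latticeOf g ↔ ∃ z : Fin n → ℤ, x = g *ᵥ fun i => (z i : ℝ) := by
  constructor
  · intro hx
    induction hx using AddSubgroup.closure_induction with
    | mem x hx => obtain ⟨z, rfl⟩ := hx; exact ⟨z, rfl⟩
    | zero => exact ⟨0, by simp [← Pi.zero_def]⟩
    | add x y _ _ hx hy =>
      obtain ⟨z, rfl⟩ := hx
      obtain ⟨t, rfl⟩ := hy
      exact ⟨z + t, by
        ext; simp [mulVec, dotProduct, mul_add, Finset.sum_add_distrib]⟩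
    | neg x _ hx =>
      obtain ⟨z, rfl⟩ := hx
      exact ⟨-z, by ext; simp [mulVec, dotProduct]⟩
  · rintro ⟨z, rfl⟩
    exact AddSubgroup.subset_closure ⟨z, rfl⟩

lemma latticeOf_eq_closure_col {n : ℕ} (g : Matrix (Fin n) (Fin n) ℝ) :
    latticeOf g = AddSubgroup.closure (Set.range g.col) := by
  refine le_antisymm ((AddSubgroup.closure_le _).mpr ?_) ((AddSubgroup.closure_le _).mpr ?_)
  · rintro _ ⟨z, rfl⟩
    have : (g *ᵥ fun i => (z i : ℝ)) = ∑ i, z i • g.col i := by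
      ext a
      simp [mulVec, dotProduct, mul_comm]
    simp only [this]
    exact AddSubgroup.sum_mem _ fun i _ =>
      AddSubgroup.zsmul_mem _ (AddSubgroup.subset_closure (Set.mem_range_self i)) _
  · rintro _ ⟨i, rfl⟩
    refine mem_latticeOf.mpr ⟨Pi.single i 1, ?_⟩
    ext a
    simp [mulVec, dotProduct, Pi.single_apply]

lemma linearIndependent_col {n : ℕ} {g : Matrix (Fin n) (Fin n) ℝ} (hg : g.det = 1) :
    LinearIndependent ℝ g.col :=
  linearIndependent_cols_of_det_ne_zero (by simp [hg])

lemma isLattice_latticeOf {n : ℕ} {g : Matrix (Fin n) (Fin n) ℝ} (hg : g.det = 1) :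
    IsLattice (latticeOf g) := by
  have hspan : Submodule.span ℝ (Set.range g.col) = ⊤ :=
    (linearIndependent_col hg).span_eq_top_of_card_eq_finrank' (by simp)
  let b := Module.Basis.mk (linearIndependent_col hg) hspan.ge
  have hb : Set.range b = Set.range g.col := by rw [Module.Basis.coe_mk]
  have h : DiscreteTopology (Submodule.span ℤ (Set.range b)).toAddSubgroup := inferInstance
  rw [hb, Submodule.span_int_eq_addSubgroupClosure] at h
  rw [latticeOf_eq_closure_col]
  refine ⟨h, ?_⟩
  rw [← top_le_iff, ← hspan]
  exact Submodule.span_mono AddSubgroup.subset_closure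

lemma GramBounded.isStable {n : ℕ} {g : Matrix (Fin n) (Fin n) ℝ} (hg : g.det = 1)
    (h : GramBounded (latticeOf g)) : IsStable (latticeOf g) := by
  have hlat := isLattice_latticeOf hg
  refine ⟨⟨hlat, le_antisymm ?_ (h.one_le_covol hlat.1 le_rfl)⟩,
    fun Λ hΛ => h.one_le_covol hlat.1 hΛ⟩
  rw [latticeOf_eq_closure_col]
  refine (covol_le_gvol (linearIndependent_col hg)).trans_eq ?_
  rw [gvol_eq, show gramMat g.col = gᵀ * gᵀᵀ from rfl]
  simp [hg]

lemma off_add_le {k : ℕ} (ns : Fin k → ℕ) {i j : Fin k} (hij : i < j) :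
    off ns i + ns i ≤ off ns j := by
  unfold off
  rw [add_comm, ← Finset.sum_insert (by simp)]
  refine Finset.sum_le_sum_of_subset fun l hl => ?_
  simp only [Finset.mem_insert, Finset.mem_filter, Finset.mem_univ, true_and] at hl ⊢
  rcases hl with rfl | hl
  · exact hij
  · exact hl.trans hij

lemma blockEmb_bijective {n k : ℕ} (ns : Fin k → ℕ) (hsum : (∑ j, ns j) = n) :
    Function.Bijective fun x : (i : Fin k) × Fin (ns i) => blockEmb ns hsum x.1 x.2 := by
  rw [Fintype.bijective_iff_injective_and_card]
  refine ⟨?_, by simp [hsum]⟩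
  rintro ⟨i, a⟩ ⟨j, b⟩ h
  have h : off ns i + (a : ℕ) = off ns j + (b : ℕ) := congrArg Fin.val h
  rcases lt_trichotomy i j with hij | rfl | hij
  · have := off_add_le ns hij
    omega
  · have : a = b := Fin.ext (by omega)
    rw [this]
  · have := off_add_le ns hij
    omega

/-- The sublattice of `latticeOf g` generated by the columns in the blocks before `m`. -/
def blockFiltration {n k : ℕ} (ns : Fin k → ℕ) (hsum : (∑ j, ns j) = n)
    (g : Matrix (Fin n) (Fin n) ℝ) (m : ℕ) : AddSubgroup (Fin n → ℝ) where
  carrier := {x | ∃ z : Fin n → ℤ, x = g *ᵥ (fun i => (z i : ℝ)) ∧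
    ∀ (i : Fin k) (a : Fin (ns i)), m ≤ i → z (blockEmb ns hsum i a) = 0}
  zero_mem' := ⟨0, by simp [← Pi.zero_def], by simp⟩
  add_mem' := by
    rintro _ _ ⟨z, rfl, hz⟩ ⟨t, rfl, ht⟩
    exact ⟨z + t, by
      ext; simp [mulVec, dotProduct, mul_add, Finset.sum_add_distrib],
      fun i a h => by simp [hz i a h, ht i a h]⟩
  neg_mem' := by
    rintro _ ⟨z, rfl, hz⟩
    exact ⟨-z, by ext; simp [mulVec, dotProduct], fun i a h => by simp [hz i a h]⟩

/-- On vectors supported on the blocks up to `m`, the `m`-th block of coordinates of `g *ᵥ z` is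
obtained by applying the `m`-th diagonal block. -/
lemma mulVec_comp_blockEmb {n k : ℕ} {ns : Fin k → ℕ} {hsum : (∑ j, ns j) = n}
    {g : Matrix (Fin n) (Fin n) ℝ} {G : ∀ i, Matrix (Fin (ns i)) (Fin (ns i)) ℝ}
    (hform : IsBlockUT ns hsum g G) {m : Fin k} {z : Fin n → ℝ}
    (hz : ∀ (i : Fin k) (a : Fin (ns i)), m < i → z (blockEmb ns hsum i a) = 0) :
    (g *ᵥ z) ∘ blockEmb ns hsum m = G m *ᵥ (z ∘ blockEmb ns hsum m) := by
  ext a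
  simp only [Function.comp_apply, mulVec, dotProduct]
  rw [← (blockEmb_bijective ns hsum).sum_comp, Fintype.sum_sigma, Finset.sum_eq_single m]
  · simp [hform.1]
  · intro i _ him
    refine Finset.sum_eq_zero fun c _ => ?_
    rcases lt_or_gt_of_ne him with h | h
    · rw [hform.2 m i a c h, zero_mul]
    · rw [hz i c h, mul_zero]
  · simp

lemma gramBounded_blockFiltration {n k : ℕ} {ns : Fin k → ℕ} {hsum : (∑ j, ns j) = n}
    {g : Matrix (Fin n) (Fin n) ℝ} {G : ∀ i, Matrix (Fin (ns i)) (Fin (ns i)) ℝ}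
    (hGdet : ∀ i, (G i).det = 1) (hform : IsBlockUT ns hsum g G)
    (hGstable : ∀ i, IsStable (latticeOf (G i))) {m : ℕ} (hm : m ≤ k) :
    GramBounded (blockFiltration ns hsum g m) := by
  induction m with
  | zero =>
    intro r v hv hvL
    rcases Nat.eq_zero_or_pos r with rfl | hr
    · simp
    · obtain ⟨z, hz, hz0⟩ := hvL ⟨0, hr⟩
      refine absurd ?_ (hv.ne_zero ⟨0, hr⟩)
      have : z = 0 := by
        ext j
        obtain ⟨⟨i, a⟩, rfl⟩ := (blockEmb_bijective ns hsum).surjective j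
        exact hz0 i a (Nat.zero_le _)
      rw [hz, this]
      simp [← Pi.zero_def]
  | succ m ih =>
    let i₀ : Fin k := ⟨m, hm⟩
    have hinj : Function.Injective (blockEmb ns hsum i₀) := fun a b h => by
      have := (blockEmb_bijective ns hsum).injective (a₁ := ⟨i₀, a⟩) (a₂ := ⟨i₀, b⟩) h
      simpa using this
    refine GramBounded.of_extension hinj (L'' := latticeOf (G i₀)) ?_ ?_ (hGstable i₀).1.1.1
      (ih (Nat.le_of_succ_le hm)) (hGstable i₀).gramBounded
    · rintro _ ⟨z, rfl, hz⟩
      rw [mulVec_comp_blockEmb hform fun i a h => by exact_mod_cast hz i a h]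
      exact mem_latticeOf.mpr ⟨z ∘ blockEmb ns hsum i₀, rfl⟩
    · rintro _ ⟨z, rfl, hz⟩ h0
      refine ⟨z, rfl, fun i a hi => ?_⟩
      rcases hi.lt_or_eq with hi | hi
      · exact hz i a hi
      obtain rfl : i₀ = i := Fin.ext hi
      rw [mulVec_comp_blockEmb hform fun i a h => by exact_mod_cast hz i a h] at h0
      have := congrFun (eq_zero_of_mulVec_eq_zero (by simp [hGdet]) h0) a
      exact Int.cast_eq_zero.mp this

end SW

/-- **Lemma 2.1.** If `g ∈ SL_n(ℝ)` is in upper triangular block form with diagonal blocks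
`G i ∈ SL_{n_i}(ℝ)` and each lattice `[G i] ∈ ℒ_{n_i}` is stable, then `[g]` is stable. -/
theorem SW.stable_of_blockUT (n k : ℕ) (hn : 0 < n) (hk : 0 < k)
    (ns : Fin k → ℕ) (hns : ∀ i, 0 < ns i) (hsum : (∑ j, ns j) = n)
    (g : Matrix (Fin n) (Fin n) ℝ) (hgdet : g.det = 1)
    (G : ∀ i, Matrix (Fin (ns i)) (Fin (ns i)) ℝ) (hGdet : ∀ i, (G i).det = 1)
    (hform : SW.IsBlockUT ns hsum g G)
    (hGstable : ∀ i, SW.IsStable (SW.latticeOf (G i))) :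
    SW.IsStable (SW.latticeOf g) := by
  refine SW.GramBounded.isStable hgdet fun r v hv hvL => ?_
  refine SW.gramBounded_blockFiltration hGdet hform hGstable le_rfl r v hv fun i => ?_
  obtain ⟨z, hz⟩ := SW.mem_latticeOf.mp (hvL i)
  exact ⟨z, hz, fun j _ hj => absurd j.isLt (not_lt.mpr hj)⟩
end
end

section
/- Let x ∈ ℒ_n and suppose the closure of A·x contains a lattice [g] where g ∈ SL_n(ℝ) is in upper triangular block form with diagonal blocks g₁,…,g_k, g_i ∈ SL_{n_i}(ℝ). Suppose for each i that [h_i] belongs to the closure of A_{n_i}·[g_i] in ℒ_{n_i}. Then there exists h ∈ SL_n(ℝ) in upper triangular block form with diagonal blocks h₁,…,h_k such that [h] belongs to the closure of A·x. -/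
open scoped BigOperators
open Matrix Topology Filter

noncomputable section

namespace SW

/-! ### Closures of orbits -/

lemma mul_mul_mem_closure_AOrbit {n : ℕ} {x g a γ : Matrix (Fin n) (Fin n) ℝ}
    (ha : a ∈ Apos n) (hγ : γ ∈ Gam n) (hg : g ∈ closure (AOrbit x)) :
    a * g * γ ∈ closure (AOrbit x) := by
  refine map_mem_closure (f := fun g => a * g * γ) (by fun_prop) hg ?_
  rintro _ ⟨a', ⟨d', hd', hdp', rfl⟩, γ', ⟨hγ1, hγ2⟩, rfl⟩
  obtain ⟨d, hd, hdp, rfl⟩ := ha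
  obtain ⟨hγ3, hγ4⟩ := hγ
  refine ⟨_, ⟨fun i => d i * d' i, fun i => mul_pos (hd i) (hd' i), ?_, rfl⟩, γ' * γ,
    ⟨by rw [Matrix.det_mul, hγ1, hγ3, one_mul], fun i j => ?_⟩, ?_⟩
  · rw [Finset.prod_mul_distrib, hdp, hdp', one_mul]
  · choose m hm using hγ2
    choose m' hm' using hγ4
    exact ⟨∑ l, m i l * m' l j, by simp [Matrix.mul_apply, hm, hm']⟩
  · rw [← Matrix.diagonal_mul_diagonal]
    simp only [Matrix.mul_assoc]

lemma isClosed_setOf_exists_mul_mem {m : Type*} [Fintype m] {K C : Set (Matrix m m ℝ)}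
    (hK : IsCompact K) (hC : IsClosed C) : IsClosed {D | ∃ u ∈ K, D * u ∈ C} := by
  have := isCompact_iff_compactSpace.1 hK
  have hcont : Continuous fun p : Matrix m m ℝ × K => p.1 * (p.2 : Matrix m m ℝ) := by fun_prop
  convert isClosedMap_fst_of_compactSpace (Y := K) _ (hC.preimage hcont) using 1
  ext D
  simp

/-! ### Block unipotent matrices -/

/-- `w` is block upper triangular with identity diagonal blocks, for the block structure
given by `b`. -/
def IsBlockUnip {m ι : Type*} [DecidableEq m] [LinearOrder ι] (b : m → ι)
    (w : Matrix m m ℝ) : Prop :=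
  ∀ p q, b q ≤ b p → w p q = (1 : Matrix m m ℝ) p q

lemma IsBlockUnip.blockTriangular {m ι : Type*} [DecidableEq m] [LinearOrder ι] {b : m → ι}
    {w : Matrix m m ℝ} (hw : IsBlockUnip b w) : w.BlockTriangular b := fun p q hpq => by
  rw [hw p q hpq.le, Matrix.one_apply_ne]
  rintro rfl
  exact hpq.false

lemma IsBlockUnip.det {m ι : Type*} [Fintype m] [DecidableEq m] [LinearOrder ι] [Fintype ι]
    {b : m → ι} {w : Matrix m m ℝ} (hw : IsBlockUnip b w) : w.det = 1 := by
  rw [hw.blockTriangular.det_fintype]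
  refine Finset.prod_eq_one fun i _ => ?_
  have : w.toSquareBlock b i = 1 := by
    ext p q
    rw [Matrix.toSquareBlock_def, Matrix.of_apply, hw _ _ (by rw [p.2, q.2])]
    simp [Matrix.one_apply, Subtype.ext_iff]
  rw [this, Matrix.det_one]

/-- The compact set of block unipotent matrices with entries in `[0, 1]`. -/
def unipBox {m ι : Type*} [DecidableEq m] [LinearOrder ι] (b : m → ι) : Set (Matrix m m ℝ) :=
  {u | IsBlockUnip b u ∧ ∀ p q, u p q ∈ Set.Icc (0 : ℝ) 1}

lemma isCompact_unipBox {m ι : Type*} [DecidableEq m] [LinearOrder ι] (b : m → ι) :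
    IsCompact (unipBox b) := by
  have hbox : IsCompact {u : Matrix m m ℝ | ∀ p q, u p q ∈ Set.Icc (0 : ℝ) 1} := by
    have hpi : IsCompact (Set.univ.pi fun _ : m => Set.univ.pi fun _ : m => Set.Icc (0 : ℝ) 1) :=
      isCompact_univ_pi fun _ => isCompact_univ_pi fun _ => isCompact_Icc
    simp only [Set.pi, Set.mem_univ, true_imp_iff] at hpi
    exact hpi
  have hclosed : IsClosed {u : Matrix m m ℝ | IsBlockUnip b u} := by
    simp only [IsBlockUnip, Set.ofPred_forall]
    refine isClosed_iInter fun p => isClosed_iInter fun q => isClosed_iInter fun _ => ?_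
    exact isClosed_eq (continuous_id.matrix_elem p q) continuous_const
  exact hbox.inter_left hclosed

lemma IsBlockUnip.exists_int_reduce_column {m : Type*} [Fintype m] [DecidableEq m] {b : m → ℕ}
    {w : Matrix m m ℝ} (hw : IsBlockUnip b w) (v : m → ℝ) (s l : ℕ) :
    ∃ c : m → ℤ, (∀ p, s ≤ b p → c p = 0) ∧
      ∀ p, s ≤ b p + l → b p < s → (v + w *ᵥ fun q => (c q : ℝ)) p ∈ Set.Icc (0 : ℝ) 1 := by
  induction l with
  | zero => exact ⟨0, fun _ _ => rfl, fun p h1 h2 => absurd h1 (by omega)⟩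
  | succ l ih =>
    obtain ⟨c, hc0, hc⟩ := ih
    set y := v + w *ᵥ fun q => (c q : ℝ) with hy
    let d : m → ℤ := fun p => if b p + (l + 1) = s then -⌊y p⌋ else 0
    have hwd : ∀ p, s ≤ b p + (l + 1) → (w *ᵥ fun q => (d q : ℝ)) p = d p := by
      intro p hp
      rw [Matrix.mulVec, dotProduct, Finset.sum_eq_single p]
      · rw [hw p p le_rfl, Matrix.one_apply_eq, one_mul]
      · intro q _ hqp
        by_cases hq : b q + (l + 1) = s
        · rw [hw p q (by omega), Matrix.one_apply_ne hqp.symm, zero_mul]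
        · simp [d, hq]
      · simp
    refine ⟨c + d, fun p hp => ?_, fun p hp hps => ?_⟩
    · simp [d, hc0 p hp, show ¬ b p + (l + 1) = s by omega]
    · have hsplit : (v + w *ᵥ fun q => ((c + d) q : ℝ)) p = y p + d p := by
        rw [← hwd p hp, hy]
        simp only [Pi.add_apply, Int.cast_add, Matrix.mulVec, dotProduct, mul_add,
          Finset.sum_add_distrib]
        ring
      rw [hsplit]
      by_cases h : b p + (l + 1) = s
      · simp only [d, h, if_true, Int.cast_neg, ← sub_eq_add_neg]
        exact ⟨Int.fract_nonneg _, (Int.fract_lt_one _).le⟩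
      · simp only [d, h, if_false, Int.cast_zero, add_zero]
        exact hc p (by omega) hps

/-- A block unipotent real matrix can be reduced modulo block unipotent integer matrices. -/
lemma IsBlockUnip.exists_int_mul_mem_unipBox {m : Type*} [Fintype m] [DecidableEq m] {k : ℕ}
    {b : m → Fin k} {w : Matrix m m ℝ} (hw : IsBlockUnip b w) :
    ∃ δ : Matrix m m ℝ, δ.det = 1 ∧ (∀ p q, ∃ z : ℤ, δ p q = z) ∧ w * δ ∈ unipBox b := by
  have hw' : IsBlockUnip (fun p => (b p : ℕ)) w := fun p q h => hw p q h
  choose c hc0 hc using fun q => hw'.exists_int_reduce_column (fun p => w p q) (b q) (b q)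
  let δ : Matrix m m ℝ := 1 + Matrix.of fun p q => (c q p : ℝ)
  have hδ : IsBlockUnip b δ := fun p q h => by simp [δ, hc0 q p h]
  have hmul : ∀ p q, (w * δ) p q = ((fun p => w p q) + w *ᵥ fun l => (c q l : ℝ)) p := by
    intro p q
    simp only [δ, Matrix.mul_add, Matrix.mul_one, Matrix.add_apply, Pi.add_apply]
    rfl
  have hwδ : IsBlockUnip b (w * δ) := by
    intro p q h
    rw [hmul, Pi.add_apply, hw p q h, Matrix.mulVec, dotProduct, Finset.sum_eq_zero, add_zero]
    intro l _
    rcases le_or_gt (b q) (b l) with hl | hl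
    · rw [hc0 q l hl, Int.cast_zero, mul_zero]
    · rw [hw.blockTriangular (hl.trans_le h), zero_mul]
  refine ⟨δ, hδ.det, fun p q => ⟨(1 : Matrix m m ℤ) p q + c q p, ?_⟩, hwδ, fun p q => ?_⟩
  · simp [δ, Matrix.one_apply]
  · rcases le_or_gt (b q) (b p) with h | h
    · rw [hwδ p q h, Matrix.one_apply]
      split_ifs <;> simp
    · rw [hmul]
      exact hc q p (by simp) h

/-! ### Matrices indexed by blocks -/

section Blocks

variable {k : ℕ} {ns : Fin k → ℕ}

lemma det_of_blockTriangular_fst {M : Matrix (Σ i, Fin (ns i)) (Σ i, Fin (ns i)) ℝ}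
    (hM : M.BlockTriangular Sigma.fst) :
    M.det = ∏ i, (Matrix.of fun p q : Fin (ns i) => M ⟨i, p⟩ ⟨i, q⟩).det := by
  rw [hM.det_fintype]
  refine Finset.prod_congr rfl fun i _ => ?_
  rw [← Matrix.det_submatrix_equiv_self (Equiv.sigmaSubtype i).symm]
  rfl

lemma det_blockDiagonal'_eq_one {N : ∀ i, Matrix (Fin (ns i)) (Fin (ns i)) ℝ}
    (hN : ∀ i, (N i).det = 1) : (Matrix.blockDiagonal' N).det = 1 := by
  rw [det_of_blockTriangular_fst (Matrix.blockTriangular_blockDiagonal' N)]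
  refine Finset.prod_eq_one fun i _ => ?_
  rw [← hN i]
  congr 1
  ext p q
  simp [Matrix.blockDiagonal'_apply_eq]

lemma blockDiagonal'_mul_apply (N : ∀ i, Matrix (Fin (ns i)) (Fin (ns i)) ℝ)
    (M : Matrix (Σ i, Fin (ns i)) (Σ i, Fin (ns i)) ℝ) (i j : Fin k) (p : Fin (ns i))
    (q : Fin (ns j)) :
    (Matrix.blockDiagonal' N * M) ⟨i, p⟩ ⟨j, q⟩ =
      (N i * Matrix.of fun p q => M ⟨i, p⟩ ⟨j, q⟩) p q := by
  rw [Matrix.mul_apply, Fintype.sum_sigma, Finset.sum_eq_single i]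
  · simp [Matrix.mul_apply, Matrix.blockDiagonal'_apply_eq]
  · intro l _ hl
    simp [Matrix.blockDiagonal'_apply_ne _ _ _ hl.symm]
  · simp

lemma mul_blockDiagonal'_apply (N : ∀ i, Matrix (Fin (ns i)) (Fin (ns i)) ℝ)
    (M : Matrix (Σ i, Fin (ns i)) (Σ i, Fin (ns i)) ℝ) (i j : Fin k) (p : Fin (ns i))
    (q : Fin (ns j)) :
    (M * Matrix.blockDiagonal' N) ⟨i, p⟩ ⟨j, q⟩ =
      ((Matrix.of fun p q => M ⟨i, p⟩ ⟨j, q⟩) * N j) p q := by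
  rw [Matrix.mul_apply, Fintype.sum_sigma, Finset.sum_eq_single j]
  · simp [Matrix.mul_apply, Matrix.blockDiagonal'_apply_eq]
  · intro l _ hl
    simp [Matrix.blockDiagonal'_apply_ne _ _ _ hl]
  · simp

/-- A block triangular matrix is, up to its block diagonal part, block unipotent. -/
lemma isBlockUnip_blockDiagonal'_inv_mul {P : ∀ i, Matrix (Fin (ns i)) (Fin (ns i)) ℝ}
    (hP : ∀ i, (P i).det = 1) {M : Matrix (Σ i, Fin (ns i)) (Σ i, Fin (ns i)) ℝ}
    (hM : M.BlockTriangular Sigma.fst) (hMP : ∀ i p q, M ⟨i, p⟩ ⟨i, q⟩ = P i p q) :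
    IsBlockUnip Sigma.fst (Matrix.blockDiagonal' (fun i => (P i)⁻¹) * M) := by
  rintro ⟨i, p⟩ ⟨j, q⟩ (hji : j ≤ i)
  rcases hji.eq_or_lt with rfl | hji
  · have hblock : (Matrix.of fun p q => M ⟨j, p⟩ ⟨j, q⟩) = P j := by
      ext p q
      exact hMP j p q
    rw [blockDiagonal'_mul_apply, hblock, Matrix.nonsing_inv_mul _ (by simp [hP j])]
    simp [Matrix.one_apply]
  · rw [((Matrix.blockTriangular_blockDiagonal' _).mul hM) hji, Matrix.one_apply_ne]
    simp [hji.ne']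

lemma off_add_le_off (ns : Fin k → ℕ) {i j : Fin k} (hij : i < j) :
    off ns i + ns i ≤ off ns j := by
  have hi : i ∉ Finset.univ.filter (fun l => l < i) := by simp
  rw [off, add_comm, ← Finset.sum_insert hi]
  refine Finset.sum_le_sum_of_subset fun l hl => ?_
  simp only [Finset.mem_insert, Finset.mem_filter, Finset.mem_univ, true_and] at hl ⊢
  rcases hl with rfl | hl
  · exact hij
  · exact hl.trans hij

/-- The identification of the blocks' coordinates with `Fin n`. -/
def blockEquiv {n : ℕ} (ns : Fin k → ℕ) (hsum : (∑ j, ns j) = n) :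
    (Σ i, Fin (ns i)) ≃ Fin n :=
  Equiv.ofBijective (fun p => blockEmb ns hsum p.1 p.2) <| by
    rw [Fintype.bijective_iff_injective_and_card]
    refine ⟨?_, by simp [hsum]⟩
    rintro ⟨i, p⟩ ⟨j, q⟩ h
    have hval : off ns i + (p : ℕ) = off ns j + (q : ℕ) := congrArg Fin.val h
    have hp := p.isLt
    have hq := q.isLt
    rcases lt_trichotomy i j with hij | rfl | hij
    · have := off_add_le_off ns hij
      omega
    · rw [Fin.ext (show (p : ℕ) = q by omega)]
    · have := off_add_le_off ns hij
      omega

@[simp]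
lemma blockEquiv_symm_blockEmb {n : ℕ} (hsum : (∑ j, ns j) = n) (i : Fin k) (p : Fin (ns i)) :
    (blockEquiv ns hsum).symm (blockEmb ns hsum i p) = ⟨i, p⟩ :=
  (blockEquiv ns hsum).symm_apply_apply ⟨i, p⟩

lemma submatrix_mem_Gam {n : ℕ} {m : Type*} [Fintype m] [DecidableEq m] (e : m ≃ Fin n)
    {γ : Matrix m m ℝ} (hdet : γ.det = 1) (hint : ∀ p q, ∃ z : ℤ, γ p q = z) :
    γ.submatrix e.symm e.symm ∈ Gam n :=
  ⟨by rw [Matrix.det_submatrix_equiv_self, hdet], fun _ _ => hint _ _⟩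

lemma blockDiagonal'_submatrix_mem_Gam {n : ℕ} (e : (Σ i, Fin (ns i)) ≃ Fin n)
    {γ : ∀ i, Matrix (Fin (ns i)) (Fin (ns i)) ℝ} (hγ : ∀ i, γ i ∈ Gam (ns i)) :
    (Matrix.blockDiagonal' γ).submatrix e.symm e.symm ∈ Gam n := by
  refine submatrix_mem_Gam e (det_blockDiagonal'_eq_one fun i => (hγ i).1) ?_
  rintro ⟨i, p⟩ ⟨j, q⟩
  by_cases hij : i = j
  · subst hij
    rw [Matrix.blockDiagonal'_apply_eq]
    exact (hγ i).2 p q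
  · exact ⟨0, by rw [Matrix.blockDiagonal'_apply_ne _ _ _ hij, Int.cast_zero]⟩

lemma blockDiagonal'_submatrix_mem_Apos {n : ℕ} (e : (Σ i, Fin (ns i)) ≃ Fin n)
    {a : ∀ i, Matrix (Fin (ns i)) (Fin (ns i)) ℝ} (ha : ∀ i, a i ∈ Apos (ns i)) :
    (Matrix.blockDiagonal' a).submatrix e.symm e.symm ∈ Apos n := by
  choose d hd hprod hdiag using ha
  obtain rfl : a = fun i => Matrix.diagonal (d i) := funext hdiag
  refine ⟨fun l => d (e.symm l).1 (e.symm l).2, fun l => hd _ _, ?_, ?_⟩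
  · rw [e.symm.prod_comp (fun p : Σ i, Fin (ns i) => d p.1 p.2), Fintype.prod_sigma]
    exact Finset.prod_eq_one fun i _ => hprod i
  · rw [Matrix.blockDiagonal'_diagonal, Matrix.submatrix_diagonal_equiv]
    rfl

lemma IsBlockUnip.isBlockUT {n : ℕ} (hsum : (∑ j, ns j) = n)
    (H : ∀ i, Matrix (Fin (ns i)) (Fin (ns i)) ℝ)
    {u : Matrix (Σ i, Fin (ns i)) (Σ i, Fin (ns i)) ℝ} (hu : IsBlockUnip Sigma.fst u) :
    IsBlockUT ns hsum ((Matrix.blockDiagonal' H * u).submatrix (blockEquiv ns hsum).symm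
      (blockEquiv ns hsum).symm) H := by
  refine ⟨fun i p q => ?_, fun i j p q hji => ?_⟩
  · have hblock : (Matrix.of fun p q : Fin (ns i) => u ⟨i, p⟩ ⟨i, q⟩) = 1 := by
      ext p q
      rw [Matrix.of_apply, hu ⟨i, p⟩ ⟨i, q⟩ le_rfl]
      simp [Matrix.one_apply]
    simp [blockDiagonal'_mul_apply, hblock]
  · simp only [Matrix.submatrix_apply, blockEquiv_symm_blockEmb]
    exact (Matrix.blockTriangular_blockDiagonal' H).mul hu.blockTriangular hji

/-- If `[g]` lies in the orbit closure of `[x]` and `P i` lies in the orbit of the `i`-th diagonal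
block of `g`, then some block triangular matrix with diagonal blocks `P i` and bounded unipotent
part lies in the orbit closure of `[x]`. -/
lemma IsBlockUT.exists_mem_unipBox {n : ℕ} {hsum : (∑ j, ns j) = n}
    {x g : Matrix (Fin n) (Fin n) ℝ} {G : ∀ i, Matrix (Fin (ns i)) (Fin (ns i)) ℝ}
    (hform : IsBlockUT ns hsum g G) (hGdet : ∀ i, (G i).det = 1) (hg : g ∈ closure (AOrbit x))
    {P : ∀ i, Matrix (Fin (ns i)) (Fin (ns i)) ℝ} (hP : ∀ i, P i ∈ AOrbit (G i)) :
    ∃ u ∈ unipBox Sigma.fst, (Matrix.blockDiagonal' P * u).submatrix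
      (blockEquiv ns hsum).symm (blockEquiv ns hsum).symm ∈ closure (AOrbit x) := by
  choose a ha γ hγ hPeq using hP
  set e := blockEquiv ns hsum
  have hPdet : ∀ i, (P i).det = 1 := by
    intro i
    obtain ⟨d, -, hd, hda⟩ := ha i
    rw [hPeq, Matrix.det_mul, Matrix.det_mul, hGdet, (hγ i).1, hda, Matrix.det_diagonal, hd]
    norm_num
  let g' := g.submatrix e e
  have hg' : g'.BlockTriangular Sigma.fst := fun p q hpq => hform.2 _ _ _ _ hpq
  let M := Matrix.blockDiagonal' a * g' * Matrix.blockDiagonal' γ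
  have hM : M.BlockTriangular Sigma.fst :=
    ((Matrix.blockTriangular_blockDiagonal' a).mul hg').mul
      (Matrix.blockTriangular_blockDiagonal' γ)
  have hMP : ∀ i p q, M ⟨i, p⟩ ⟨i, q⟩ = P i p q := by
    intro i p q
    have hGi : (Matrix.of fun p q => g' ⟨i, p⟩ ⟨i, q⟩) = G i := by
      ext p q
      exact hform.1 i p q
    have haG : (Matrix.of fun p q => (Matrix.blockDiagonal' a * g') ⟨i, p⟩ ⟨i, q⟩) =
        a i * G i := by
      ext p q
      rw [Matrix.of_apply, blockDiagonal'_mul_apply, hGi]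
    change (Matrix.blockDiagonal' a * g' * Matrix.blockDiagonal' γ) ⟨i, p⟩ ⟨i, q⟩ = P i p q
    rw [mul_blockDiagonal'_apply, haG, hPeq]
  obtain ⟨δ, hδdet, hδint, hδ⟩ :=
    (isBlockUnip_blockDiagonal'_inv_mul hPdet hM hMP).exists_int_mul_mem_unipBox
  refine ⟨_, hδ, ?_⟩
  have hcancel : Matrix.blockDiagonal' P *
      (Matrix.blockDiagonal' (fun i => (P i)⁻¹) * M * δ) = M * δ := by
    have hone : (fun i => P i * (P i)⁻¹) = 1 :=
      funext fun i => Matrix.mul_nonsing_inv _ (by simp [hPdet i])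
    rw [← Matrix.mul_assoc, ← Matrix.mul_assoc, ← Matrix.blockDiagonal'_mul, hone,
      Matrix.blockDiagonal'_one, Matrix.one_mul]
  have hg'' : g = g'.submatrix e.symm e.symm := by
    ext p q
    simp [g']
  have hone : (1 : Matrix (Fin n) (Fin n) ℝ) ∈ Apos n :=
    ⟨1, fun _ => one_pos, by simp, Matrix.diagonal_one.symm⟩
  have hmem := mul_mul_mem_closure_AOrbit hone (submatrix_mem_Gam e hδdet hδint)
    (mul_mul_mem_closure_AOrbit (blockDiagonal'_submatrix_mem_Apos e ha)
      (blockDiagonal'_submatrix_mem_Gam e hγ) hg)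
  rw [hg'', Matrix.one_mul, Matrix.submatrix_mul_equiv, Matrix.submatrix_mul_equiv,
    Matrix.submatrix_mul_equiv] at hmem
  rwa [hcancel]

end Blocks

end SW

/-- **Lemma 2.2.** Suppose `cl(A·[x])` contains `[g]` with `g` in upper triangular block form
with diagonal blocks `G i`, and `[H i] ∈ cl(A_{n_i}·[G i])` for each `i`. Then there is `h`
in upper triangular block form with diagonal blocks `H i` such that `[h] ∈ cl(A·[x])`. -/
theorem SW.blockUT_in_orbit_closure (n k : ℕ) (hn : 0 < n) (hk : 0 < k)
    (ns : Fin k → ℕ) (hns : ∀ i, 0 < ns i) (hsum : (∑ j, ns j) = n)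
    (x : Matrix (Fin n) (Fin n) ℝ) (hx : x.det = 1)
    (g : Matrix (Fin n) (Fin n) ℝ) (hgdet : g.det = 1)
    (G : ∀ i, Matrix (Fin (ns i)) (Fin (ns i)) ℝ) (hGdet : ∀ i, (G i).det = 1)
    (hform : SW.IsBlockUT ns hsum g G)
    (hg : g ∈ closure (SW.AOrbit x))
    (H : ∀ i, Matrix (Fin (ns i)) (Fin (ns i)) ℝ) (hHdet : ∀ i, (H i).det = 1)
    (hH : ∀ i, H i ∈ closure (SW.AOrbit (G i))) :
    ∃ h : Matrix (Fin n) (Fin n) ℝ, h.det = 1 ∧ SW.IsBlockUT ns hsum h H ∧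
      h ∈ closure (SW.AOrbit x) := by
  have hclosed : IsClosed {P : ∀ i, Matrix (Fin (ns i)) (Fin (ns i)) ℝ |
      ∃ u ∈ SW.unipBox Sigma.fst, (Matrix.blockDiagonal' P * u).submatrix
        (SW.blockEquiv ns hsum).symm (SW.blockEquiv ns hsum).symm ∈ closure (SW.AOrbit x)} :=
    (SW.isClosed_setOf_exists_mul_mem (SW.isCompact_unipBox Sigma.fst)
      (isClosed_closure.preimage (continuous_id.matrix_submatrix
        (SW.blockEquiv ns hsum).symm (SW.blockEquiv ns hsum).symm))).preimage
      (continuous_id.matrix_blockDiagonal')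
  have hHmem : H ∈ closure (Set.univ.pi fun i => SW.AOrbit (G i)) := by
    rw [closure_pi_set]
    exact fun i _ => hH i
  obtain ⟨u, hu, hmem⟩ := closure_minimal
    (fun _ hP => hform.exists_mem_unipBox hGdet hg fun i => Set.mem_univ_pi.1 hP i) hclosed hHmem
  refine ⟨_, ?_, hu.1.isBlockUT hsum H, hmem⟩
  rw [Matrix.det_submatrix_equiv_self, Matrix.det_mul, SW.det_blockDiagonal'_eq_one hHdet,
    hu.1.det, one_mul]
end
end

section
/- For every x ∈ ℒ_n there exists a lattice [g] in the closure of A·x such that, after a permutation of the coordinates of ℝⁿ, g is in upper triangular block form with diagonal blocks g₁,…,g_k, g_i ∈ SL_{n_i}(ℝ), and for each i the orbit A_{n_i}·[g_i] ⊆ ℒ_{n_i} is bounded (has compact closure). -/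
open scoped BigOperators
open Matrix Topology Filter

noncomputable section

namespace SW

/-! ### Reduction theory by integral column operations -/

/-- An integral matrix viewed as a real matrix. -/
def toReal {ι κ : Type} (γ : Matrix ι κ ℤ) : Matrix ι κ ℝ := γ.map (fun m => (m : ℝ))

lemma toReal_mul {ι κ μ : Type} [Fintype κ] (γ : Matrix ι κ ℤ) (δ : Matrix κ μ ℤ) :
    toReal (γ * δ) = toReal γ * toReal δ := by
  ext i j
  simp [toReal, Matrix.mul_apply]

lemma toReal_one {ι : Type} [DecidableEq ι] : toReal (1 : Matrix ι ι ℤ) = 1 := by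
  ext i j
  simp [toReal, Matrix.one_apply]

lemma det_toReal {ι : Type} [Fintype ι] [DecidableEq ι] (γ : Matrix ι ι ℤ) :
    (toReal γ).det = (γ.det : ℝ) := (Int.cast_det γ).symm

/-- The entries in any column of `g * γ`, for `γ` integral and nonsingular, are not all small. -/
lemma exists_le_abs_mul_toReal {ι : Type} [Fintype ι] [DecidableEq ι] (g : Matrix ι ι ℝ)
    (hg : g.det ≠ 0) :
    ∃ c > 0, ∀ γ : Matrix ι ι ℤ, IsUnit γ.det → ∀ j, c ≤ ‖fun i => (g * toReal γ) i j‖ := by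
  set S : ℝ := ∑ i, ∑ j, |g⁻¹ i j| with hS
  have hS0 : 0 ≤ S := Finset.sum_nonneg fun i _ => Finset.sum_nonneg fun j _ => abs_nonneg _
  refine ⟨1 / (S + 1), by positivity, fun γ hγ j => ?_⟩
  have hdet : γ.det ≠ 0 := hγ.ne_zero
  obtain ⟨i, hi⟩ : ∃ i, γ i j ≠ 0 := by
    by_contra! h
    exact hdet (Matrix.det_eq_zero_of_column_eq_zero j h)
  have h1 : (1 : ℝ) ≤ |(γ i j : ℝ)| := by
    rw [← Int.cast_abs]
    exact_mod_cast Int.one_le_abs hi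
  have h2 : (γ i j : ℝ) = ∑ k, g⁻¹ i k * (g * toReal γ) k j := by
    have : g⁻¹ * (g * toReal γ) = toReal γ := by
      rw [← Matrix.mul_assoc, Matrix.nonsing_inv_mul _ (isUnit_iff_ne_zero.mpr hg), Matrix.one_mul]
    rw [← Matrix.mul_apply, this]
    rfl
  set v : ι → ℝ := fun i => (g * toReal γ) i j with hv
  have h3 : |(γ i j : ℝ)| ≤ S * ‖v‖ := by
    rw [h2]
    calc |∑ k, g⁻¹ i k * v k| ≤ ∑ k, |g⁻¹ i k| * ‖v‖ := by
          refine (Finset.abs_sum_le_sum_abs _ _).trans (Finset.sum_le_sum fun k _ => ?_)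
          rw [abs_mul]
          exact mul_le_mul_of_nonneg_left (norm_le_pi_norm v k) (abs_nonneg _)
      _ = (∑ k, |g⁻¹ i k|) * ‖v‖ := by rw [Finset.sum_mul]
      _ ≤ S * ‖v‖ := by
          refine mul_le_mul_of_nonneg_right ?_ (norm_nonneg _)
          exact Finset.single_le_sum (f := fun i => ∑ k, |g⁻¹ i k|)
            (fun i _ => Finset.sum_nonneg fun j _ => abs_nonneg _) (Finset.mem_univ i)
  rw [div_le_iff₀ (by positivity)]
  nlinarith [norm_nonneg v]

/-- Some integral change of basis makes the first column of `g` nearly shortest among all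
columns occurring in such changes of basis. -/
lemma exists_nearly_shortest_column {n : ℕ} (g : Matrix (Fin (n + 1)) (Fin (n + 1)) ℝ)
    (hg : g.det ≠ 0) :
    ∃ γ : Matrix (Fin (n + 1)) (Fin (n + 1)) ℤ, IsUnit γ.det ∧
      0 < ‖fun i => (g * toReal γ) i 0‖ ∧
      ∀ δ : Matrix (Fin (n + 1)) (Fin (n + 1)) ℤ, IsUnit δ.det → ∀ j,
        ‖fun i => (g * toReal γ) i 0‖ ≤ 3 / 2 * ‖fun i => (g * toReal δ) i j‖ := by
  obtain ⟨c, hc, hle⟩ := exists_le_abs_mul_toReal g hg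
  set T : Set ℝ := {t | ∃ γ : Matrix (Fin (n + 1)) (Fin (n + 1)) ℤ, IsUnit γ.det ∧
    ∃ j, t = ‖fun i => (g * toReal γ) i j‖} with hT
  have hne : T.Nonempty := ⟨_, 1, by simp, 0, rfl⟩
  have hlow : ∀ t ∈ T, c ≤ t := by
    rintro t ⟨γ, hγ, j, rfl⟩
    exact hle γ hγ j
  have hbdd : BddBelow T := ⟨c, hlow⟩
  have hpos : 0 < sInf T := hc.trans_le (le_csInf hne hlow)
  obtain ⟨t, ⟨γ, hγ, j, rfl⟩, ht⟩ := exists_lt_of_csInf_lt hne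
    (show sInf T < 3 / 2 * sInf T by linarith)
  have hcol : ∀ i, (g * toReal (γ.submatrix id (Equiv.swap 0 j))) i 0 = (g * toReal γ) i j := by
    intro i
    simp [Matrix.mul_apply, toReal]
  refine ⟨γ.submatrix id (Equiv.swap 0 j), ?_, ?_, fun δ hδ k => ?_⟩
  · rw [Matrix.det_permute']
    exact (Units.isUnit _).mul hγ
  · simp only [hcol]
    exact hc.trans_le (hle γ hγ j)
  · simp only [hcol]
    have := csInf_le hbdd (show _ ∈ T from ⟨δ, hδ, k, rfl⟩)
    linarith

lemma det_eq_mul_det_schur {n : ℕ} (M : Matrix (Fin (n + 1)) (Fin (n + 1)) ℝ) (hM : M 0 0 ≠ 0) :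
    M.det = M 0 0 *
      (Matrix.of fun i j : Fin n => M i.succ j.succ - M i.succ 0 / M 0 0 * M 0 j.succ).det := by
  set B : Matrix (Fin (n + 1)) (Fin (n + 1)) ℝ :=
    Matrix.of fun i j => M i j - (if i = 0 then 0 else M i 0 / M 0 0) * M 0 j with hB
  have h1 : M.det = B.det := by
    refine Matrix.det_eq_of_forall_row_eq_smul_add_const
      (fun i => if i = 0 then 0 else M i 0 / M 0 0) 0 (by simp) fun i j => ?_
    simp [hB]
  rw [h1, Matrix.det_succ_column_zero, Fin.sum_univ_succ, Finset.sum_eq_zero]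
  · simp only [hB, Matrix.of_apply]
    simp only [Fin.val_zero, pow_zero, if_true, zero_mul, sub_zero, one_mul, add_zero]
    congr 2
  · intro i _
    simp [hB, Fin.succ_ne_zero, hM]

/-- The integral matrix with first row `(1, z)`, first column `(1, 0)` and remaining block `γ`. -/
def bordered {n : ℕ} (z : Fin n → ℤ) (γ : Matrix (Fin n) (Fin n) ℤ) :
    Matrix (Fin (n + 1)) (Fin (n + 1)) ℤ :=
  Matrix.of (Fin.cons (Fin.cons 1 z) fun i => Fin.cons 0 (γ i))

lemma det_bordered {n : ℕ} (z : Fin n → ℤ) (γ : Matrix (Fin n) (Fin n) ℤ) :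
    (bordered z γ).det = γ.det := by
  rw [Matrix.det_succ_column_zero, Fin.sum_univ_succ, Finset.sum_eq_zero]
  · simp [bordered]
    rfl
  · intro i _
    simp [bordered]

lemma mul_bordered_zero {n : ℕ} {κ : Type} (M : Matrix κ (Fin (n + 1)) ℝ) (z : Fin n → ℤ)
    (γ : Matrix (Fin n) (Fin n) ℤ) (i : κ) : (M * toReal (bordered z γ)) i 0 = M i 0 := by
  simp [Matrix.mul_apply, Fin.sum_univ_succ, toReal, bordered]

lemma mul_bordered_succ {n : ℕ} {κ : Type} (M : Matrix κ (Fin (n + 1)) ℝ) (z : Fin n → ℤ)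
    (γ : Matrix (Fin n) (Fin n) ℤ) (i : κ) (j : Fin n) :
    (M * toReal (bordered z γ)) i j.succ = M i 0 * z j + ∑ k, M i k.succ * (γ k j : ℝ) := by
  simp [Matrix.mul_apply, Fin.sum_univ_succ, toReal, bordered]

/-- Every real `u ≠ 0` reduces any real modulo `u` to size at most `|u| / 2`. -/
lemma exists_int_abs_mul_add_le (u s : ℝ) (hu : u ≠ 0) : ∃ z : ℤ, |u * z + s| ≤ |u| / 2 := by
  refine ⟨-round (s / u), ?_⟩
  have h := abs_sub_round (s / u)
  have : u * ((-round (s / u) : ℤ) : ℝ) + s = u * (s / u - round (s / u)) := by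
    push_cast
    field_simp
    ring
  rw [this, abs_mul]
  nlinarith [abs_nonneg u]

/-- The size estimates describing a matrix reduced with respect to the ordering `σ` of its rows,
with pivots `d`. -/
structure IsReduced {n : ℕ} {ι : Type} (C : ℝ) (M : Matrix ι (Fin n) ℝ) (σ : Fin n ≃ ι)
    (d : Fin n → ℝ) : Prop where
  pos : ∀ i, 0 < d i
  entry_le : ∀ i j, |M (σ i) j| ≤ C * d (min i j)
  pivot_le : ∀ i j, i ≤ j → d i ≤ C * d j

lemma exists_isReduced (n : ℕ) :
    ∃ C : ℝ, 1 ≤ C ∧ ∀ g : Matrix (Fin n) (Fin n) ℝ, g.det ≠ 0 →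
      ∃ (γ : Matrix (Fin n) (Fin n) ℤ) (σ : Equiv.Perm (Fin n)) (d : Fin n → ℝ),
        IsUnit γ.det ∧ ∏ i, d i = |g.det| ∧ IsReduced C (g * toReal γ) σ d ∧
        ∀ (h : 0 < n) (i : Fin n), |(g * toReal γ) i ⟨0, h⟩| ≤ d ⟨0, h⟩ := by
  induction n with
  | zero =>
    exact ⟨1, le_rfl, fun g hg => ⟨1, 1, fun i => i.elim0, by simp, by simp,
      ⟨fun i => i.elim0, fun i => i.elim0, fun i => i.elim0⟩, fun h => absurd h (lt_irrefl 0)⟩⟩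
  | succ n ih =>
    obtain ⟨C, hC1, hC⟩ := ih
    refine ⟨6 * C, by linarith, fun g hg => ?_⟩
    obtain ⟨γ₁, hγ₁, hpos, hmin⟩ := exists_nearly_shortest_column g hg
    set v : Fin (n + 1) → ℝ := fun i => (g * toReal γ₁) i 0 with hv
    obtain ⟨p, hp⟩ : ∃ p, ∀ i, |v i| ≤ |v p| := Finite.exists_max fun i => |v i|
    have hvp : ‖v‖ = |v p| :=
      le_antisymm ((pi_norm_le_iff_of_nonneg (abs_nonneg _)).mpr hp) (norm_le_pi_norm v p)
    set M : Matrix (Fin (n + 1)) (Fin (n + 1)) ℝ :=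
      (g * toReal γ₁).submatrix (Equiv.swap 0 p) id with hM
    have hM0 : ∀ i, M i 0 = v (Equiv.swap 0 p i) := fun i => rfl
    have hu : M 0 0 = v p := by rw [hM0, Equiv.swap_apply_left]
    have hupos : 0 < |M 0 0| := by rw [hu, ← hvp]; exact hpos
    have hu0 : M 0 0 ≠ 0 := abs_pos.mp hupos
    have hcol : ∀ i, |M i 0| ≤ |M 0 0| := fun i => by rw [hu, hM0]; exact hp _
    set S : Matrix (Fin n) (Fin n) ℝ :=
      Matrix.of fun i j : Fin n => M i.succ j.succ - M i.succ 0 / M 0 0 * M 0 j.succ with hS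
    have hdetM : |M.det| = |g.det| := by
      rw [hM, Matrix.det_permute, abs_mul, Matrix.det_mul, det_toReal, abs_mul]
      have h1 : |(γ₁.det : ℝ)| = 1 := by
        rw [← Int.cast_abs, Int.isUnit_iff_abs_eq.mp hγ₁, Int.cast_one]
      have h2 : |((Equiv.Perm.sign (Equiv.swap 0 p) : ℤ) : ℝ)| = 1 := by
        rw [← Int.cast_abs, Int.isUnit_iff_abs_eq.mp (Units.isUnit _), Int.cast_one]
      rw [h1, h2, one_mul, mul_one]
    have hdetS : |M 0 0| * |S.det| = |g.det| := by
      rw [← hdetM, det_eq_mul_det_schur M hu0, abs_mul]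
    have hS0 : S.det ≠ 0 := by
      intro h
      rw [h, abs_zero, mul_zero] at hdetS
      exact hg (abs_eq_zero.mp hdetS.symm)
    obtain ⟨γ₂, σ₂, d₂, hγ₂, hd₂, hred, hfirst⟩ := hC S hS0
    choose z hz using fun j => exists_int_abs_mul_add_le (M 0 0)
      (∑ k, M 0 k.succ * (γ₂ k j : ℝ)) hu0
    set W : Matrix (Fin (n + 1)) (Fin (n + 1)) ℝ := M * toReal (bordered z γ₂) with hW
    have hW0 : ∀ i, W i 0 = M i 0 := mul_bordered_zero M z γ₂
    have hrow : ∀ j : Fin n, |W 0 j.succ| ≤ |M 0 0| / 2 := fun j => by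
      rw [hW, mul_bordered_succ]
      exact hz j
    have hWS : ∀ i j : Fin n,
        W i.succ j.succ = (S * toReal γ₂) i j + M i.succ 0 / M 0 0 * W 0 j.succ := by
      intro i j
      rw [hW, mul_bordered_succ, mul_bordered_succ, Matrix.mul_apply]
      simp only [hS, Matrix.of_apply, toReal, Matrix.map_apply, sub_mul, Finset.sum_sub_distrib,
        mul_add, Finset.mul_sum]
      have : M i.succ 0 / M 0 0 * (M 0 0 * (z j : ℝ)) = M i.succ 0 * z j := by field_simp
      rw [this]
      have : ∀ k, M i.succ 0 / M 0 0 * M 0 k.succ * (γ₂ k j : ℝ) =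
        M i.succ 0 / M 0 0 * (M 0 k.succ * (γ₂ k j : ℝ)) := fun k => by ring
      simp only [this]
      ring
    have hWSle : ∀ i j : Fin n, |W i.succ j.succ| ≤ |(S * toReal γ₂) i j| + |M 0 0| / 2 := by
      intro i j
      rw [hWS]
      refine (abs_add_le _ _).trans (add_le_add_right ?_ _)
      rw [abs_mul, abs_div]
      have h1 : |M i.succ 0| / |M 0 0| ≤ 1 := (div_le_one hupos).mpr (hcol _)
      calc |M i.succ 0| / |M 0 0| * |W 0 j.succ| ≤ 1 * |W 0 j.succ| :=
            mul_le_mul_of_nonneg_right h1 (abs_nonneg _)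
        _ ≤ _ := by rw [one_mul]; exact hrow j
    have hWg : ∀ i j, (g * toReal (γ₁ * bordered z γ₂)) i j = W (Equiv.swap 0 p i) j := by
      intro i j
      rw [toReal_mul, ← Matrix.mul_assoc, hW, Matrix.mul_apply, Matrix.mul_apply]
      simp [hM]
    have hunit : IsUnit (γ₁ * bordered z γ₂).det := by
      rw [Matrix.det_mul, det_bordered]
      exact hγ₁.mul hγ₂
    have hpiv : ∀ j, |M 0 0| ≤ 6 * C * d₂ j := by
      intro j
      have hn : 0 < n := j.pos
      have h1 := hmin _ hunit (Fin.succ ⟨0, hn⟩)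
      rw [hvp, ← hu] at h1
      have hd0 : 0 < d₂ ⟨0, hn⟩ := hred.pos _
      have h2 : ‖fun i => (g * toReal (γ₁ * bordered z γ₂)) i (Fin.succ ⟨0, hn⟩)‖ ≤
          d₂ ⟨0, hn⟩ + |M 0 0| / 2 := by
        rw [pi_norm_le_iff_of_nonneg (by positivity)]
        intro i
        rw [hWg, Real.norm_eq_abs]
        refine Fin.cases ?_ (fun k => ?_) (Equiv.swap 0 p i)
        · exact (hrow _).trans (by linarith)
        · exact (hWSle _ _).trans (by linarith [hfirst hn k])
      have h3 := hred.pivot_le ⟨0, hn⟩ j (Fin.mk_le_of_le_val (Nat.zero_le _))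
      linarith
    refine ⟨γ₁ * bordered z γ₂, Equiv.Perm.decomposeFin.symm (p, σ₂), Fin.cons |M 0 0| d₂,
      hunit, ?_, ⟨?_, ?_, ?_⟩, ?_⟩
    · rw [Fin.prod_univ_succ]
      simp only [Fin.cons_zero, Fin.cons_succ]
      rw [hd₂, hdetS]
    · exact fun i => Fin.cases hupos (fun k => hred.pos k) i
    · intro i j
      rw [hWg]
      have h6 : |M 0 0| ≤ 6 * C * |M 0 0| := by nlinarith
      refine Fin.cases ?_ (fun i => ?_) i
      · rw [Equiv.Perm.decomposeFin_symm_apply_zero, Equiv.swap_apply_right]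
        have : min (0 : Fin (n + 1)) j = 0 := min_eq_left (Fin.zero_le _)
        rw [this, Fin.cons_zero]
        refine Fin.cases ?_ (fun j => ?_) j
        · rw [hW0]; exact h6
        · linarith [hrow j]
      · rw [Equiv.Perm.decomposeFin_symm_apply_succ, Equiv.swap_apply_self]
        refine Fin.cases ?_ (fun j => ?_) j
        · have : min i.succ (0 : Fin (n + 1)) = 0 := min_eq_right (Fin.zero_le _)
          rw [this, Fin.cons_zero, hW0]
          exact (hcol _).trans h6
        · have : min i.succ j.succ = (min i j).succ := (Fin.strictMono_succ.monotone.map_min).symm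
          rw [this, Fin.cons_succ]
          have h1 := hWSle (σ₂ i) j
          have h2 := hred.entry_le i j
          have h3 := hpiv (min i j)
          have h4 := mul_pos (zero_lt_one.trans_le hC1) (hred.pos (min i j))
          linarith
    · intro i j
      induction i using Fin.cases with
      | zero =>
        intro _
        induction j using Fin.cases with
        | zero =>
          simp only [Fin.cons_zero]
          nlinarith
        | succ j => simpa using hpiv j
      | succ i =>
        induction j using Fin.cases with
        | zero => exact fun h => absurd h (by simp)
        | succ j =>
          intro h
          have h1 := hred.pivot_le i j (Fin.succ_le_succ_iff.mp h)
          have h4 := mul_pos (zero_lt_one.trans_le hC1) (hred.pos j)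
          simp only [Fin.cons_succ]
          linarith
    · intro h i
      have : (⟨0, h⟩ : Fin (n + 1)) = 0 := rfl
      rw [this, hWg, hW0, Fin.cons_zero]
      exact hcol _

/-! ### Orbits over arbitrary finite index types -/

lemma isCompact_entries_le {ι κ : Type} (R : ℝ) :
    IsCompact {Y : Matrix ι κ ℝ | ∀ i j, |Y i j| ≤ R} := by
  have h : IsCompact (Set.univ.pi fun _ : ι => Set.univ.pi fun _ : κ => Set.Icc (-R) R) :=
    isCompact_univ_pi fun _ => isCompact_univ_pi fun _ => isCompact_Icc
  refine h.of_isClosed_subset ?_ fun Y hY => ?_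
  · simp only [Set.ofPred_forall]
    exact isClosed_iInter fun i => isClosed_iInter fun j =>
      isClosed_le (continuous_id.matrix_elem i j).abs continuous_const
  · exact fun i _ j _ => abs_le.mp (hY i j)

section Orbit

variable {ι κ : Type} [Fintype ι] [DecidableEq ι] [Fintype κ] [DecidableEq κ]

/-- `AOrbit` for matrices indexed by an arbitrary finite type. -/
def orbit (x : Matrix ι ι ℝ) : Set (Matrix ι ι ℝ) :=
  {p | ∃ d : ι → ℝ, (∀ i, 0 < d i) ∧ ∏ i, d i = 1 ∧
    ∃ γ : Matrix ι ι ℤ, γ.det = 1 ∧ p = Matrix.diagonal d * x * toReal γ}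

/-- `HasBoundedAOrbit` for matrices indexed by an arbitrary finite type. -/
def IsBoundedOrbit (x : Matrix ι ι ℝ) : Prop :=
  ∃ R : ℝ, ∀ d : ι → ℝ, (∀ i, 0 < d i) → ∏ i, d i = 1 →
    ∃ γ : Matrix ι ι ℤ, γ.det = 1 ∧ ∀ i j, |(Matrix.diagonal d * x * toReal γ) i j| ≤ R

lemma self_mem_orbit (x : Matrix ι ι ℝ) : x ∈ orbit x :=
  ⟨fun _ => 1, fun _ => one_pos, by simp, 1, by simp, by simp [toReal_one]⟩

lemma det_of_mem_orbit {x p : Matrix ι ι ℝ} (hp : p ∈ orbit x) : p.det = x.det := by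
  obtain ⟨d, -, hd, γ, hγ, rfl⟩ := hp
  rw [Matrix.det_mul, Matrix.det_mul, Matrix.det_diagonal, hd, det_toReal, hγ]
  simp

lemma det_of_mem_closure_orbit {x p : Matrix ι ι ℝ} (hp : p ∈ closure (orbit x)) :
    p.det = x.det := by
  have hc : IsClosed {q : Matrix ι ι ℝ | q.det = x.det} :=
    isClosed_eq (continuous_id.matrix_det) continuous_const
  exact closure_minimal (fun q hq => det_of_mem_orbit hq) hc hp

lemma mul_mem_orbit {x p : Matrix ι ι ℝ} (hp : p ∈ orbit x) {d : ι → ℝ} (hd : ∀ i, 0 < d i)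
    (hd1 : ∏ i, d i = 1) {γ : Matrix ι ι ℤ} (hγ : γ.det = 1) :
    Matrix.diagonal d * p * toReal γ ∈ orbit x := by
  obtain ⟨d', hd', hd1', γ', hγ', rfl⟩ := hp
  refine ⟨fun i => d i * d' i, fun i => mul_pos (hd i) (hd' i), ?_, γ' * γ, ?_, ?_⟩
  · rw [Finset.prod_mul_distrib, hd1, hd1', one_mul]
  · rw [Matrix.det_mul, hγ, hγ', one_mul]
  · rw [toReal_mul, ← Matrix.diagonal_mul_diagonal]
    simp only [Matrix.mul_assoc]

lemma closure_orbit_subset {x y : Matrix ι ι ℝ} (hy : y ∈ closure (orbit x)) :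
    closure (orbit y) ⊆ closure (orbit x) := by
  refine closure_minimal ?_ isClosed_closure
  rintro p ⟨d, hd, hd1, γ, hγ, rfl⟩
  refine map_mem_closure (f := fun p => Matrix.diagonal d * p * toReal γ) ?_ hy
    fun q hq => mul_mem_orbit hq hd hd1 hγ
  fun_prop

lemma diagonal_mul_mul_toReal_apply (d : ι → ℝ) (x : Matrix ι ι ℝ) (γ : Matrix ι ι ℤ) (i j : ι) :
    (Matrix.diagonal d * x * toReal γ) i j = ∑ k, d i * x i k * (γ k j : ℝ) := by
  rw [Matrix.mul_apply]
  simp only [Matrix.diagonal_mul, toReal, Matrix.map_apply]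

lemma submatrix_mem_orbit {x p : Matrix ι ι ℝ} (hp : p ∈ orbit x) (e : κ ≃ ι) :
    p.submatrix e e ∈ orbit (x.submatrix e e) := by
  obtain ⟨d, hd, hd1, γ, hγ, rfl⟩ := hp
  refine ⟨d ∘ e, fun i => hd _, ?_, γ.submatrix e e, ?_, ?_⟩
  · rw [← hd1]
    exact Equiv.prod_comp e d
  · rw [Matrix.det_submatrix_equiv_self, hγ]
  · ext i j
    simp only [Matrix.submatrix_apply, diagonal_mul_mul_toReal_apply, Function.comp_apply]
    exact (Equiv.sum_comp e fun k => d (e i) * x (e i) k * (γ k (e j) : ℝ)).symm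

lemma IsBoundedOrbit.submatrix {x : Matrix ι ι ℝ} (hx : IsBoundedOrbit x) (e : κ ≃ ι) :
    IsBoundedOrbit (x.submatrix e e) := by
  obtain ⟨R, hR⟩ := hx
  refine ⟨R, fun d hd hd1 => ?_⟩
  obtain ⟨γ, hγ, hle⟩ := hR (d ∘ e.symm) (fun i => hd _) (by
    rw [← hd1]
    exact Equiv.prod_comp e.symm d)
  refine ⟨γ.submatrix e e, by rw [Matrix.det_submatrix_equiv_self, hγ], fun i j => ?_⟩
  refine le_of_eq_of_le ?_ (hle (e i) (e j))
  congr 1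
  simp only [Matrix.submatrix_apply, diagonal_mul_mul_toReal_apply, Function.comp_apply,
    Equiv.symm_apply_apply]
  exact Equiv.sum_comp e fun k => d i * x (e i) k * (γ k (e j) : ℝ)

lemma mem_closure_aOrbit {n : ℕ} {x g : Matrix (Fin n) (Fin n) ℝ} (hg : g ∈ closure (orbit x)) :
    g ∈ closure (AOrbit x) := by
  refine closure_mono ?_ hg
  rintro p ⟨d, hd, hd1, γ, hγ, rfl⟩
  exact ⟨_, ⟨d, hd, hd1, rfl⟩, toReal γ,
    ⟨by rw [det_toReal, hγ, Int.cast_one], fun i j => ⟨γ i j, rfl⟩⟩, rfl⟩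

lemma IsBoundedOrbit.hasBoundedAOrbit {n : ℕ} {x : Matrix (Fin n) (Fin n) ℝ}
    (hx : IsBoundedOrbit x) : HasBoundedAOrbit x := by
  obtain ⟨R, hR⟩ := hx
  refine ⟨_, isCompact_entries_le R, ?_⟩
  rintro a ⟨d, hd, hd1, rfl⟩
  obtain ⟨γ, hγ, hle⟩ := hR d hd hd1
  exact ⟨toReal γ, ⟨by rw [det_toReal, hγ, Int.cast_one], fun i j => ⟨γ i j, rfl⟩⟩, hle⟩

/-- A nonsingular integral matrix can be given determinant one by changing the signs of its
columns. -/
lemma exists_sign_det_one (γ : Matrix ι ι ℤ) (hγ : IsUnit γ.det) :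
    ∃ s : ι → ℤ, (∀ i, |s i| = 1) ∧ (γ * Matrix.diagonal s).det = 1 := by
  cases isEmpty_or_nonempty ι with
  | inl h => exact ⟨fun _ => 1, fun _ => abs_one, by simp⟩
  | inr h =>
    obtain ⟨p⟩ := h
    refine ⟨fun i => if i = p then γ.det else 1, fun i => ?_, ?_⟩
    · dsimp only
      split_ifs
      · exact Int.isUnit_iff_abs_eq.mp hγ
      · exact abs_one
    · rw [Matrix.det_mul, Matrix.det_diagonal, Finset.prod_ite_eq' Finset.univ p]
      simpa using Int.isUnit_mul_self hγ

lemma exists_isReduced_det_one (n : ℕ) :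
    ∃ C : ℝ, 1 ≤ C ∧ ∀ (ι : Type) [Fintype ι] [DecidableEq ι] (_ : Fin n ≃ ι)
      (g : Matrix ι ι ℝ), g.det = 1 →
      ∃ (γ : Matrix ι ι ℤ) (σ : Fin n ≃ ι) (d : Fin n → ℝ), γ.det = 1 ∧ ∏ i, d i = 1 ∧
        IsReduced C ((g * toReal γ).submatrix id σ) σ d := by
  obtain ⟨C, hC1, hC⟩ := exists_isReduced n
  refine ⟨C, hC1, fun ι _ _ e g hg => ?_⟩
  obtain ⟨γ, σ, d, hγ, hd, hred, -⟩ := hC (g.submatrix e e) (by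
    rw [Matrix.det_submatrix_equiv_self, hg]
    exact one_ne_zero)
  set δ : Matrix ι ι ℤ := (γ.submatrix id σ.symm).submatrix e.symm e.symm with hδ
  have hδu : IsUnit δ.det := by
    rw [hδ, Matrix.det_submatrix_equiv_self, Matrix.det_permute']
    exact (Units.isUnit _).mul hγ
  obtain ⟨s, hs, hdet⟩ := exists_sign_det_one δ hδu
  refine ⟨δ * Matrix.diagonal s, σ.trans e, d, hdet, ?_, hred.pos, fun i j => ?_, hred.pivot_le⟩
  · rw [hd, Matrix.det_submatrix_equiv_self, hg, abs_one]
  · have h1 : (g * toReal (δ * Matrix.diagonal s)) (e (σ i)) (e (σ j)) =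
        (g.submatrix e e * toReal γ) (σ i) j * s (e (σ j)) := by
      rw [Matrix.mul_apply, Matrix.mul_apply, Finset.sum_mul, ← Equiv.sum_comp e]
      simp [hδ, toReal, Matrix.mul_diagonal, mul_assoc]
    have h2 : |(s (e (σ j)) : ℝ)| = 1 := by rw [← Int.cast_abs, hs, Int.cast_one]
    have h3 := hred.entry_le i j
    simp only [Matrix.submatrix_apply, id_eq, Equiv.trans_apply]
    rwa [h1, abs_mul, h2, mul_one]

/-- If consecutive pivots of a reduced matrix of determinant one have bounded ratios, then all
the pivots are bounded. -/
lemma pivot_le_of_ratio_le {n : ℕ} {C B : ℝ} (hC : 1 ≤ C) (hB : 1 ≤ B) {d : Fin n → ℝ}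
    (hd : ∀ i, 0 < d i) (hd1 : ∏ i, d i = 1) (hle : ∀ i j, i ≤ j → d i ≤ C * d j)
    (hratio : ∀ l m : Fin n, (m : ℕ) = l + 1 → d m ≤ B * d l) (i : Fin n) :
    d i ≤ C * B ^ n := by
  have hBn : 1 ≤ B ^ n := one_le_pow₀ hB
  have hchain : ∀ (i : Fin n) (k : ℕ) (h : i + k < n), d ⟨i + k, h⟩ ≤ B ^ k * d i := by
    intro i k
    induction k with
    | zero => intro h; simp
    | succ k ih =>
      intro h
      have h1 := ih (by omega)
      have h2 := hratio ⟨i + k, by omega⟩ ⟨i + (k + 1), h⟩ (by simp; omega)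
      calc _ ≤ B * d ⟨i + k, by omega⟩ := h2
        _ ≤ B * (B ^ k * d i) := mul_le_mul_of_nonneg_left h1 (by linarith)
        _ = _ := by ring
  have hall : ∀ i j, d i ≤ C * B ^ n * d j := by
    intro i j
    rcases le_total i j with h | h
    · refine (hle i j h).trans (mul_le_mul_of_nonneg_right ?_ (hd j).le)
      nlinarith
    · have h1 := hchain j (i - j) (by omega)
      have h2 : (⟨j + (i - j), by omega⟩ : Fin n) = i := Fin.ext (by simp; omega)
      rw [h2] at h1
      refine h1.trans (mul_le_mul_of_nonneg_right ?_ (hd j).le)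
      have h3 : B ^ ((i : ℕ) - j) ≤ B ^ n := pow_le_pow_right₀ hB (by omega)
      nlinarith
  by_contra! hlt
  have hR : 0 < C * B ^ n := by positivity
  have h1 : ∏ _j : Fin n, (1 : ℝ) < ∏ j, d j := by
    refine Finset.prod_lt_prod_of_nonempty (fun _ _ => one_pos) (fun j _ => ?_) ⟨i, by simp⟩
    have := hall i j
    by_contra! h
    nlinarith
  rw [hd1] at h1
  simp at h1

/-- If the orbit of `x` is unbounded, then it accumulates at a reducible matrix. -/
lemma exists_reducible_of_not_isBoundedOrbit {x : Matrix ι ι ℝ} (hx : x.det = 1)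
    (hunb : ¬ IsBoundedOrbit x) :
    ∃ y ∈ closure (orbit x), ∃ s : ι → Prop, (∃ p, s p) ∧ (∃ p, ¬ s p) ∧
      ∀ p q, ¬ s p → s q → y p q = 0 := by
  obtain ⟨n, ⟨e⟩⟩ : ∃ n, Nonempty (Fin n ≃ ι) := ⟨_, ⟨(Fintype.equivFin ι).symm⟩⟩
  obtain ⟨C, hC1, hC⟩ := exists_isReduced_det_one n
  have hC0 : 0 < C := by linarith
  have hdet : ∀ d : ι → ℝ, ∏ i, d i = 1 → (Matrix.diagonal d * x).det = 1 := fun d hd => by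
    rw [Matrix.det_mul, Matrix.det_diagonal, hd, hx, one_mul]
  let Q : ℝ → (Fin n ≃ ι) × Fin n × Fin n → Prop := fun B t =>
    (t.2.2 : ℕ) = t.2.1 + 1 ∧ ∃ Y ∈ orbit x, (∀ p q, |Y p q| ≤ C ^ 2) ∧
      ∀ i j, j ≤ t.2.1 → t.2.2 ≤ i → |Y (t.1 i) (t.1 j)| ≤ C ^ 3 / B
  have hQ : ∀ B : ℝ, 1 ≤ B → ∃ t, Q B t := by
    intro B hB
    by_contra! hno
    refine hunb ⟨C * (C * B ^ n), fun d hd hd1 => ?_⟩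
    obtain ⟨γ, σ, δ, hγ, hδ, hred⟩ := hC ι e _ (hdet d hd1)
    have hentry : ∀ i j, |(Matrix.diagonal d * x * toReal γ) (σ i) (σ j)| ≤ C * δ (min i j) :=
      hred.entry_le
    refine ⟨γ, hγ, fun p q => ?_⟩
    have hratio : ∀ l m : Fin n, (m : ℕ) = l + 1 → δ m ≤ B * δ l := by
      intro l m hlm
      by_contra! hlt
      refine hno (σ, l, m) ⟨hlm, ?_⟩
      set δ' : ι → ℝ := fun p => (δ (σ.symm p))⁻¹ with hδ'
      set Y := Matrix.diagonal δ' * (Matrix.diagonal d * x * toReal γ) with hY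
      have hYmem : Y ∈ orbit x := by
        have h1 := mul_mem_orbit (x := x) ⟨d, hd, hd1, γ, hγ, rfl⟩
          (d := δ') (fun p => inv_pos.mpr (hred.pos _)) (by
            rw [hδ', Finset.prod_inv_distrib, Equiv.prod_comp σ.symm δ, hδ, inv_one])
          (γ := 1) (by simp)
        rwa [toReal_one, Matrix.mul_one] at h1
      have hYle : ∀ i j, |Y (σ i) (σ j)| ≤ C * δ (min i j) / δ i := by
        intro i j
        have hi := hred.pos i
        have hδi : δ' (σ i) = (δ i)⁻¹ := by simp [hδ']
        rw [hY, Matrix.diagonal_mul, abs_mul, hδi, abs_inv, abs_of_pos hi, div_eq_inv_mul]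
        exact mul_le_mul_of_nonneg_left (hentry i j) (inv_pos.mpr hi).le
      refine ⟨Y, hYmem, fun p q => ?_, fun i j hj hi => ?_⟩
      · have h1 := hYle (σ.symm p) (σ.symm q)
        simp only [Equiv.apply_symm_apply] at h1
        refine h1.trans ?_
        rw [div_le_iff₀ (hred.pos _), pow_two, mul_assoc]
        exact mul_le_mul_of_nonneg_left (hred.pivot_le _ _ (min_le_left _ _)) hC0.le
      · dsimp only at hi hj ⊢
        refine (hYle i j).trans ?_
        have hlm' : l < m := by
          rw [Fin.lt_def]
          omega
        have hmin : min i j = j := min_eq_right (hj.trans (hlm'.le.trans hi))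
        rw [hmin, div_le_div_iff₀ (hred.pos _) (by linarith)]
        have h1 := hred.pivot_le j l hj
        have h2 := hred.pivot_le m i hi
        calc C * δ j * B ≤ C * (C * δ l) * B := by gcongr
          _ = C ^ 2 * (B * δ l) := by ring
          _ ≤ C ^ 2 * (C * δ i) := by
            refine mul_le_mul_of_nonneg_left (hlt.le.trans h2) (by positivity)
          _ = C ^ 3 * δ i := by ring
    have h1 := hentry (σ.symm p) (σ.symm q)
    simp only [Equiv.apply_symm_apply] at h1
    exact h1.trans (mul_le_mul_of_nonneg_left
      (pivot_le_of_ratio_le hC1 hB hred.pos hδ hred.pivot_le hratio _) hC0.le)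
  obtain ⟨⟨σ, l, m⟩, ht⟩ : ∃ t, ∀ B : ℝ, 1 ≤ B → Q B t := by
    by_contra! hno
    choose b hb1 hb using hno
    obtain ⟨B, hB⟩ := (Set.finite_range b).bddAbove
    obtain ⟨t, hlm, Y, hY, hY1, hY2⟩ := hQ (max B 1) (le_max_right _ _)
    refine hb t ⟨hlm, Y, hY, hY1, fun i j hj hi => (hY2 i j hj hi).trans ?_⟩
    refine div_le_div_of_nonneg_left (by positivity) (zero_lt_one.trans_le (hb1 t)) ?_
    exact (hB ⟨t, rfl⟩).trans (le_max_left _ _)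
  have hlm : (m : ℕ) = l + 1 := (ht 1 le_rfl).1
  let K : ℕ → Set (Matrix ι ι ℝ) := fun k => closure (orbit x) ∩
    ({Y | ∀ p q, |Y p q| ≤ C ^ 2} ∩
      {Y | ∀ i j, j ≤ l → m ≤ i → |Y (σ i) (σ j)| ≤ C ^ 3 / ((k : ℝ) + 1)})
  have hclosed : ∀ k, IsClosed
      {Y : Matrix ι ι ℝ | ∀ i j, j ≤ l → m ≤ i → |Y (σ i) (σ j)| ≤ C ^ 3 / ((k : ℝ) + 1)} := by
    intro k
    simp only [Set.ofPred_forall]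
    refine isClosed_iInter fun i => isClosed_iInter fun j => isClosed_iInter fun _ =>
      isClosed_iInter fun _ => isClosed_le ?_ continuous_const
    exact (continuous_id.matrix_elem _ _).abs
  have hcompact : ∀ k, IsCompact (K k) := fun k =>
    ((isCompact_entries_le _).inter_right (hclosed k)).inter_left isClosed_closure
  obtain ⟨y, hy⟩ := IsCompact.nonempty_iInter_of_sequence_nonempty_isCompact_isClosed K
    (fun k Y hY => ⟨hY.1, hY.2.1, fun i j hj hi => (hY.2.2 i j hj hi).trans (by
      push_cast
      gcongr
      linarith)⟩)
    (fun k => by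
      obtain ⟨-, Y, hY, hY1, hY2⟩ := ht ((k : ℝ) + 1) (by linarith [k.cast_nonneg (α := ℝ)])
      exact ⟨Y, subset_closure hY, hY1, hY2⟩)
    (hcompact 0) (fun k => (hcompact k).isClosed)
  rw [Set.mem_iInter] at hy
  refine ⟨y, (hy 0).1, fun p => σ.symm p ≤ l, ⟨σ l, by simp⟩, ⟨σ m, ?_⟩, fun p q hp hq => ?_⟩
  · simp only [Equiv.symm_apply_apply, not_le, Fin.lt_def]
    omega
  · have hlim : Tendsto (fun k : ℕ => C ^ 3 / ((k : ℝ) + 1)) atTop (𝓝 0) := by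
      have := (tendsto_one_div_add_atTop_nhds_zero_nat (𝕜 := ℝ)).const_mul (C ^ 3)
      simpa [div_eq_mul_inv] using this
    have hle : ∀ k : ℕ, |y p q| ≤ C ^ 3 / ((k : ℝ) + 1) := fun k => by
      have := (hy k).2.2 (σ.symm p) (σ.symm q) hq (by
        rw [not_le, Fin.lt_def] at hp
        rw [Fin.le_def]
        omega)
      simpa using this
    exact abs_nonpos_iff.mp (ge_of_tendsto' hlim hle)

end Orbit

/-! ### Block triangular matrices in orbit closures -/

section Blocks

variable {ι κ : Type} [Fintype ι] [DecidableEq ι] [Fintype κ] [DecidableEq κ]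

lemma toReal_fromBlocks {ι κ : Type} (A : Matrix ι ι ℤ) (B : Matrix ι κ ℤ) (C : Matrix κ ι ℤ)
    (D : Matrix κ κ ℤ) : toReal (Matrix.fromBlocks A B C D) =
      Matrix.fromBlocks (toReal A) (toReal B) (toReal C) (toReal D) :=
  Matrix.fromBlocks_map _ _ _ _ _

lemma toReal_zero {ι κ : Type} : toReal (0 : Matrix ι κ ℤ) = 0 := by
  ext i j
  simp [toReal]

lemma exists_fromBlocks_mem_orbit {X₁ : Matrix ι ι ℝ} {X₂ : Matrix κ κ ℝ} (B : Matrix ι κ ℝ)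
    (h₁ : X₁.det = 1) {p₁ : Matrix ι ι ℝ} {p₂ : Matrix κ κ ℝ} (hp₁ : p₁ ∈ orbit X₁)
    (hp₂ : p₂ ∈ orbit X₂) :
    ∃ F : Matrix ι κ ℝ, (∀ i j, |F i j| ≤ 1 / 2) ∧
      Matrix.fromBlocks p₁ (p₁ * F) 0 p₂ ∈ orbit (Matrix.fromBlocks X₁ B 0 X₂) := by
  have hdet : p₁.det = 1 := (det_of_mem_orbit hp₁).trans h₁
  obtain ⟨d₁, hd₁, hd₁', γ₁, hγ₁, rfl⟩ := hp₁
  obtain ⟨d₂, hd₂, hd₂', γ₂, hγ₂, rfl⟩ := hp₂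
  set p₁ := Matrix.diagonal d₁ * X₁ * toReal γ₁ with hp₁
  set T : Matrix ι κ ℝ := p₁⁻¹ * (Matrix.diagonal d₁ * B * toReal γ₂) with hT
  have hpT : p₁ * T = Matrix.diagonal d₁ * B * toReal γ₂ := by
    rw [hT, ← Matrix.mul_assoc, Matrix.mul_nonsing_inv _ (by rw [hdet]; exact isUnit_one),
      Matrix.one_mul]
  set Z : Matrix ι κ ℤ := Matrix.of fun i j => -round (T i j) with hZ
  refine ⟨toReal Z + T, fun i j => ?_, Sum.elim d₁ d₂, ?_, ?_,
    Matrix.fromBlocks γ₁ (γ₁ * Z) 0 γ₂, ?_, ?_⟩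
  · have : (toReal Z + T) i j = T i j - round (T i j) := by
      simp [toReal, hZ]
      ring
    rw [this]
    exact abs_sub_round _
  · rintro (i | i)
    exacts [hd₁ i, hd₂ i]
  · rw [Fintype.prod_sum_type]
    simp [hd₁', hd₂']
  · rw [Matrix.det_fromBlocks_zero₂₁, hγ₁, hγ₂, one_mul]
  · rw [← Matrix.fromBlocks_diagonal, toReal_fromBlocks, Matrix.fromBlocks_multiply,
      Matrix.fromBlocks_multiply, toReal_zero, toReal_mul, Matrix.mul_add, hpT]
    simp [hp₁, Matrix.mul_assoc]

lemma exists_fromBlocks_mem_closure_orbit {X₁ : Matrix ι ι ℝ} {X₂ : Matrix κ κ ℝ}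
    (B : Matrix ι κ ℝ) (hX₁ : X₁.det = 1) {h₁ : Matrix ι ι ℝ} {h₂ : Matrix κ κ ℝ}
    (hh₁ : h₁ ∈ closure (orbit X₁)) (hh₂ : h₂ ∈ closure (orbit X₂)) :
    ∃ H : Matrix ι κ ℝ,
      Matrix.fromBlocks h₁ H 0 h₂ ∈ closure (orbit (Matrix.fromBlocks X₁ B 0 X₂)) := by
  have : FirstCountableTopology (Matrix ι ι ℝ) :=
    inferInstanceAs (FirstCountableTopology (ι → ι → ℝ))
  have : FirstCountableTopology (Matrix κ κ ℝ) :=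
    inferInstanceAs (FirstCountableTopology (κ → κ → ℝ))
  have : FirstCountableTopology (Matrix ι κ ℝ) :=
    inferInstanceAs (FirstCountableTopology (ι → κ → ℝ))
  obtain ⟨u₁, hu₁, hlim₁⟩ := mem_closure_iff_seq_limit.mp hh₁
  obtain ⟨u₂, hu₂, hlim₂⟩ := mem_closure_iff_seq_limit.mp hh₂
  choose F hF hmem using fun k => exists_fromBlocks_mem_orbit B hX₁ (hu₁ k) (hu₂ k)
  obtain ⟨F', -, φ, hφ, hlimF⟩ := (isCompact_entries_le (ι := ι) (κ := κ) (1 / 2)).tendsto_subseq hF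
  refine ⟨h₁ * F', mem_closure_of_tendsto (b := atTop)
    (f := fun k => Matrix.fromBlocks (u₁ (φ k)) (u₁ (φ k) * F (φ k)) 0 (u₂ (φ k))) ?_
    (Eventually.of_forall fun k => hmem (φ k))⟩
  have hcont : Continuous fun t : Matrix ι ι ℝ × Matrix ι κ ℝ × Matrix κ κ ℝ =>
      Matrix.fromBlocks t.1 (t.1 * t.2.1) 0 t.2.2 :=
    Continuous.matrix_fromBlocks (by fun_prop) (by fun_prop) continuous_const (by fun_prop)
  exact (hcont.tendsto (h₁, F', h₂)).comp ((hlim₁.comp hφ.tendsto_atTop).prodMk_nhds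
    (hlimF.prodMk_nhds (hlim₂.comp hφ.tendsto_atTop)))

/-- Scaling and a sign change normalize the determinant of a nonsingular matrix. -/
lemma exists_scale_sign [Nonempty ι] {Y : Matrix ι ι ℝ} (hY : Y.det ≠ 0) :
    ∃ t : ℝ, 0 < t ∧ t ^ Fintype.card ι = |Y.det|⁻¹ ∧
      ∃ s : Matrix ι ι ℤ, Y.det * (s.det : ℝ) = |Y.det| := by
  obtain ⟨p⟩ := ‹Nonempty ι›
  have hpos : 0 < |Y.det|⁻¹ := inv_pos.mpr (abs_pos.mpr hY)
  refine ⟨_, Real.rpow_pos_of_pos hpos _,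
    Real.rpow_inv_natCast_pow hpos.le (Fintype.card_pos_iff.mpr ⟨p⟩).ne',
    Matrix.diagonal fun i => if i = p then (if 0 < Y.det then 1 else -1) else 1, ?_⟩
  rw [Matrix.det_diagonal, Finset.prod_ite_eq' Finset.univ p]
  simp only [Finset.mem_univ, if_true]
  split_ifs with h
  · simp [abs_of_pos h]
  · simp [abs_of_nonpos (not_lt.mp h)]

lemma exists_fromBlocks_det_one [Nonempty ι] [Nonempty κ] {Y₁ : Matrix ι ι ℝ} {B : Matrix ι κ ℝ}
    {Y₂ : Matrix κ κ ℝ} (hdet : (Matrix.fromBlocks Y₁ B 0 Y₂).det = 1) :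
    ∃ (Z₁ : Matrix ι ι ℝ) (B' : Matrix ι κ ℝ) (Z₂ : Matrix κ κ ℝ), Z₁.det = 1 ∧ Z₂.det = 1 ∧
      Matrix.fromBlocks Z₁ B' 0 Z₂ ∈ orbit (Matrix.fromBlocks Y₁ B 0 Y₂) := by
  rw [Matrix.det_fromBlocks_zero₂₁] at hdet
  have hY₁ : Y₁.det ≠ 0 := left_ne_zero_of_mul_eq_one hdet
  have hY₂ : Y₂.det ≠ 0 := right_ne_zero_of_mul_eq_one hdet
  obtain ⟨t₁, ht₁, htc₁, s₁, hs₁⟩ := exists_scale_sign hY₁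
  obtain ⟨t₂, ht₂, htc₂, s₂, hs₂⟩ := exists_scale_sign hY₂
  have habs : |Y₁.det| * |Y₂.det| = 1 := by rw [← abs_mul, hdet, abs_one]
  refine ⟨Matrix.diagonal (fun _ : ι => t₁) * Y₁ * toReal s₁,
    Matrix.diagonal (fun _ : ι => t₁) * B * toReal s₂,
    Matrix.diagonal (fun _ : κ => t₂) * Y₂ * toReal s₂, ?_, ?_,
    Sum.elim (fun _ : ι => t₁) fun _ : κ => t₂, ?_, ?_, Matrix.fromBlocks s₁ 0 0 s₂, ?_, ?_⟩
  · rw [Matrix.det_mul, Matrix.det_mul, Matrix.det_diagonal, Finset.prod_const, Finset.card_univ,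
      htc₁, det_toReal, mul_assoc, hs₁, inv_mul_cancel₀ (abs_ne_zero.mpr hY₁)]
  · rw [Matrix.det_mul, Matrix.det_mul, Matrix.det_diagonal, Finset.prod_const, Finset.card_univ,
      htc₂, det_toReal, mul_assoc, hs₂, inv_mul_cancel₀ (abs_ne_zero.mpr hY₂)]
  · rintro (i | i)
    exacts [ht₁, ht₂]
  · rw [Fintype.prod_sum_type]
    simp only [Sum.elim_inl, Sum.elim_inr, Finset.prod_const, Finset.card_univ]
    rw [htc₁, htc₂, ← mul_inv, habs, inv_one]
  · rw [Matrix.det_fromBlocks_zero₂₁]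
    have : (s₁.det : ℝ) * s₂.det = 1 := by
      calc (s₁.det : ℝ) * s₂.det = (Y₁.det * Y₂.det) * (s₁.det * s₂.det) := by rw [hdet, one_mul]
        _ = (Y₁.det * s₁.det) * (Y₂.det * s₂.det) := by ring
        _ = 1 := by rw [hs₁, hs₂, habs]
    exact_mod_cast this
  · rw [← Matrix.fromBlocks_diagonal, toReal_fromBlocks, Matrix.fromBlocks_multiply,
      Matrix.fromBlocks_multiply, toReal_zero, toReal_zero]
    simp

/-- The orbit closure of `x` contains a matrix which is block triangular with respect to some
level function on the index set, with diagonal blocks of determinant one having bounded orbits. -/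
def HasBoundedBlocks (x : Matrix ι ι ℝ) : Prop :=
  ∃ g ∈ closure (orbit x), ∃ f : ι → ℕ, (∀ p q, f q < f p → g p q = 0) ∧
    ∀ (c m : ℕ) (e : Fin m → ι), Function.Injective e → (∀ p, p ∈ Set.range e ↔ f p = c) →
      (g.submatrix e e).det = 1 ∧ IsBoundedOrbit (g.submatrix e e)

lemma HasBoundedBlocks.of_mem_closure {x y : Matrix ι ι ℝ} (hy : y ∈ closure (orbit x))
    (h : HasBoundedBlocks y) : HasBoundedBlocks x := by
  obtain ⟨g, hg, hf⟩ := h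
  exact ⟨g, closure_orbit_subset hy hg, hf⟩

lemma HasBoundedBlocks.of_submatrix {x : Matrix ι ι ℝ} (e : κ ≃ ι)
    (h : HasBoundedBlocks (x.submatrix e e)) : HasBoundedBlocks x := by
  obtain ⟨g, hg, f, htri, hblock⟩ := h
  refine ⟨g.submatrix e.symm e.symm, ?_, f ∘ e.symm, fun p q hpq => htri _ _ hpq,
    fun c m e' he' hrange => ?_⟩
  · refine map_mem_closure (f := fun p : Matrix κ κ ℝ => p.submatrix e.symm e.symm)
      (continuous_id.matrix_submatrix _ _) hg fun p hp => ?_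
    have := submatrix_mem_orbit hp e.symm
    simpa using this
  · have := hblock c m (e.symm ∘ e') (e.symm.injective.comp he') fun p => by
      rw [← e.symm_apply_apply p, ← Function.comp_apply (f := f), ← hrange]
      simp [Equiv.symm_apply_eq]
    simpa using this

lemma HasBoundedBlocks.fromBlocks {X₁ : Matrix ι ι ℝ} {X₂ : Matrix κ κ ℝ} (B : Matrix ι κ ℝ)
    (hX₁ : X₁.det = 1) (h₁ : HasBoundedBlocks X₁) (h₂ : HasBoundedBlocks X₂) :
    HasBoundedBlocks (Matrix.fromBlocks X₁ B 0 X₂) := by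
  obtain ⟨g₁, hg₁, f₁, htri₁, hblock₁⟩ := h₁
  obtain ⟨g₂, hg₂, f₂, htri₂, hblock₂⟩ := h₂
  obtain ⟨H, hH⟩ := exists_fromBlocks_mem_closure_orbit B hX₁ hg₁ hg₂
  obtain ⟨N, hN⟩ := (Set.finite_range f₁).bddAbove
  have hN' : ∀ p, f₁ p ≤ N := fun p => hN ⟨p, rfl⟩
  refine ⟨_, hH, Sum.elim f₁ fun q => f₂ q + (N + 1), ?_, fun c m e he hrange => ?_⟩
  · rintro (p | p) (q | q) hpq
    · exact htri₁ p q hpq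
    · have := hN' p
      simp only [Sum.elim_inl, Sum.elim_inr] at hpq
      omega
    · rfl
    · simp only [Sum.elim_inr] at hpq
      exact htri₂ p q (by omega)
  · have hlevel := fun i => (hrange (e i)).mp ⟨i, rfl⟩
    rcases Nat.lt_or_ge N c with hc | hc
    · have hinr : ∀ i, ∃ q, e i = Sum.inr q := fun i => by
        have := hlevel i
        rcases h : e i with p | q
        · rw [h, Sum.elim_inl] at this
          have := hN' p
          omega
        · exact ⟨q, rfl⟩
      choose e' he' using hinr
      obtain rfl : e = Sum.inr ∘ e' := funext he'
      refine hblock₂ (c - (N + 1)) m e' he.of_comp fun q => ?_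
      have := hrange (Sum.inr q)
      simp only [Set.mem_range, Function.comp_apply, Sum.inr.injEq, Sum.elim_inr] at this
      rw [Set.mem_range, this]
      omega
    · have hinl : ∀ i, ∃ p, e i = Sum.inl p := fun i => by
        have := hlevel i
        rcases h : e i with p | q
        · exact ⟨p, rfl⟩
        · rw [h, Sum.elim_inr] at this
          omega
      choose e' he' using hinl
      obtain rfl : e = Sum.inl ∘ e' := funext he'
      refine hblock₁ c m e' he.of_comp fun p => ?_
      have := hrange (Sum.inl p)
      simp only [Set.mem_range, Function.comp_apply, Sum.inl.injEq, Sum.elim_inl] at this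
      rw [Set.mem_range, this]

lemma IsBoundedOrbit.hasBoundedBlocks {x : Matrix ι ι ℝ} (hdet : x.det = 1)
    (hx : IsBoundedOrbit x) : HasBoundedBlocks x := by
  refine ⟨x, subset_closure (self_mem_orbit x), fun _ => 0, fun p q h => absurd h (lt_irrefl 0),
    fun c m e he hrange => ?_⟩
  by_cases hc : 0 = c
  · have hbij : Function.Bijective e := ⟨he, fun p => (hrange p).mpr hc⟩
    refine ⟨?_, hx.submatrix (Equiv.ofBijective e hbij)⟩
    rw [← hdet]
    exact Matrix.det_submatrix_equiv_self (Equiv.ofBijective e hbij) x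
  · have : IsEmpty (Fin m) := ⟨fun i => hc ((hrange (e i)).mp ⟨i, rfl⟩)⟩
    exact ⟨Matrix.det_isEmpty, 0, fun d _ _ => ⟨1, by simp, fun i => isEmptyElim i⟩⟩

end Blocks

lemma hasBoundedBlocks (N : ℕ) : ∀ (ι : Type) [Fintype ι] [DecidableEq ι],
    Fintype.card ι = N → ∀ x : Matrix ι ι ℝ, x.det = 1 → HasBoundedBlocks x := by
  induction N using Nat.strong_induction_on with
  | _ N ih =>
    intro ι _ _ hcard x hx
    by_cases hb : IsBoundedOrbit x
    · exact hb.hasBoundedBlocks hx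
    classical
    obtain ⟨y, hy, s, ⟨p, hp⟩, ⟨q, hq⟩, hzero⟩ := exists_reducible_of_not_isBoundedOrbit hx hb
    have : Nonempty {a // s a} := ⟨⟨p, hp⟩⟩
    have : Nonempty {a // ¬ s a} := ⟨⟨q, hq⟩⟩
    refine HasBoundedBlocks.of_mem_closure hy (HasBoundedBlocks.of_submatrix (Equiv.sumCompl s) ?_)
    set Y := y.submatrix (Equiv.sumCompl s) (Equiv.sumCompl s) with hY
    have hdetY : Y.det = 1 := by
      rw [hY, Matrix.det_submatrix_equiv_self, det_of_mem_closure_orbit hy, hx]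
    have h21 : Y.toBlocks₂₁ = 0 := by
      ext i j
      exact hzero i j i.2 j.2
    rw [← Matrix.fromBlocks_toBlocks Y, h21] at hdetY ⊢
    obtain ⟨Z₁, B, Z₂, hZ₁, hZ₂, hmem⟩ := exists_fromBlocks_det_one hdetY
    refine HasBoundedBlocks.of_mem_closure (subset_closure hmem)
      (HasBoundedBlocks.fromBlocks B hZ₁ ?_ ?_)
    · exact ih _ (hcard ▸ Fintype.card_subtype_lt hq) _ rfl Z₁ hZ₁
    · exact ih _ (hcard ▸ Fintype.card_subtype_lt (not_not.mpr hp)) _ rfl Z₂ hZ₂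

lemma blockEmb_eq_finSigmaFinEquiv {n k : ℕ} (ns : Fin k → ℕ) (hsum : (∑ j, ns j) = n) (i : Fin k)
    (a : Fin (ns i)) : blockEmb ns hsum i a = finCongr hsum (finSigmaFinEquiv ⟨i, a⟩) := by
  ext
  rw [finCongr_apply, Fin.val_cast, finSigmaFinEquiv_apply]
  simp only [blockEmb, off, add_left_inj]
  symm
  refine Finset.sum_bij (fun j _ => Fin.castLE i.2.le j) (fun j _ => ?_) (fun j _ j' _ h => ?_)
    (fun j hj => ?_) (fun j _ => rfl)
  · exact Finset.mem_filter.mpr ⟨Finset.mem_univ _, Fin.lt_def.mpr j.2⟩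
  · exact Fin.castLE_injective _ h
  · simp only [Finset.mem_filter, Finset.mem_univ, true_and, Fin.lt_def] at hj
    exact ⟨⟨j, hj⟩, Finset.mem_univ _, rfl⟩

/-- A level function on `Fin n` is sorted into consecutive blocks by a permutation. -/
lemma exists_perm_blockEmb {n : ℕ} (hn : 0 < n) (f : Fin n → ℕ) :
    ∃ (σ : Equiv.Perm (Fin n)) (k : ℕ) (ns : Fin k → ℕ) (hsum : (∑ j, ns j) = n) (o : Fin k → ℕ),
      0 < k ∧ (∀ i, 0 < ns i) ∧ StrictMono o ∧
      ∀ i p, p ∈ Set.range (fun a => σ (blockEmb ns hsum i a)) ↔ f p = o i := by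
  set I := Finset.univ.image f with hI
  let o := I.orderEmbOfFin rfl
  have ho : ∀ p, ∃ i, o i = f p := fun p => by
    have : f p ∈ Set.range o := by
      rw [Finset.range_orderEmbOfFin]
      exact Finset.mem_coe.mpr (Finset.mem_image_of_mem f (Finset.mem_univ p))
    exact this
  let ns : Fin I.card → ℕ := fun i => Fintype.card {p // f p = o i}
  let F : (Σ i : Fin I.card, {p // f p = o i}) ≃ Fin n :=
    Equiv.ofBijective (fun t => t.2.1) (by
      constructor
      · rintro ⟨i, p, hp⟩ ⟨j, q, hq⟩ (rfl : p = q)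
        obtain rfl : i = j := o.injective (hp.symm.trans hq)
        rfl
      · intro p
        obtain ⟨i, hi⟩ := ho p
        exact ⟨⟨i, p, hi.symm⟩, rfl⟩)
  let E : (Σ i : Fin I.card, Fin (ns i)) ≃ Fin n :=
    (Equiv.sigmaCongrRight fun i => (Fintype.equivFin {p // f p = o i}).symm).trans F
  have hsum : ∑ j, ns j = n := by simpa using Fintype.card_congr E
  refine ⟨(finCongr hsum).symm.trans (finSigmaFinEquiv.symm.trans E), I.card, ns, hsum, o, ?_, ?_,
    o.strictMono, ?_⟩
  · exact Finset.card_pos.mpr ⟨f ⟨0, hn⟩, Finset.mem_image_of_mem f (Finset.mem_univ _)⟩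
  · intro i
    obtain ⟨p, -, hp⟩ := Finset.mem_image.mp (I.orderEmbOfFin_mem rfl i)
    exact Fintype.card_pos_iff.mpr ⟨⟨p, hp⟩⟩
  · intro i p
    simp only [blockEmb_eq_finSigmaFinEquiv, Equiv.trans_apply, Equiv.symm_apply_apply]
    constructor
    · rintro ⟨a, rfl⟩
      exact ((Fintype.equivFin {p // f p = o i}).symm a).2
    · intro hp
      refine ⟨Fintype.equivFin {p // f p = o i} ⟨p, hp⟩, ?_⟩
      change F ⟨i, (Fintype.equivFin _).symm (Fintype.equivFin _ ⟨p, hp⟩)⟩ = p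
      rw [Equiv.symm_apply_apply]
      rfl

lemma blockEmb_injective {n k : ℕ} (ns : Fin k → ℕ) (hsum : (∑ j, ns j) = n) (i : Fin k) :
    Function.Injective (blockEmb ns hsum i) := by
  intro a b h
  have := congrArg Fin.val h
  simp only [blockEmb] at this
  exact Fin.ext (by omega)

end SW

/-- **Lemma 2.3.** For every `x ∈ ℒ_n` there is `[g] ∈ cl(A·x)` such that, up to a permutation
of the coordinates, `g` is in upper triangular block form whose diagonal blocks generate
lattices with bounded `A_{n_i}`-orbits. -/
theorem SW.orbit_closure_contains_blockUT_bounded (n : ℕ) (hn : 0 < n)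
    (x : Matrix (Fin n) (Fin n) ℝ) (hx : x.det = 1) :
    ∃ g ∈ closure (SW.AOrbit x), g.det = 1 ∧
      ∃ (σ : Equiv.Perm (Fin n)) (k : ℕ) (ns : Fin k → ℕ) (hsum : (∑ j, ns j) = n)
        (G : ∀ i, Matrix (Fin (ns i)) (Fin (ns i)) ℝ),
        0 < k ∧ (∀ i, 0 < ns i) ∧ (∀ i, (G i).det = 1) ∧
        SW.IsBlockUT ns hsum (g.submatrix σ σ) G ∧
        ∀ i, SW.HasBoundedAOrbit (G i) := by
  obtain ⟨g, hg, f, htri, hblock⟩ := SW.hasBoundedBlocks n (Fin n) (Fintype.card_fin n) x hx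
  obtain ⟨σ, k, ns, hsum, o, hk, hns, ho, hrange⟩ := SW.exists_perm_blockEmb hn f
  have hlevel : ∀ i a, f (σ (SW.blockEmb ns hsum i a)) = o i := fun i a =>
    (hrange i _).mp ⟨a, rfl⟩
  have hG := fun i => hblock (o i) (ns i) (fun a => σ (SW.blockEmb ns hsum i a))
    (σ.injective.comp (SW.blockEmb_injective ns hsum i)) (hrange i)
  refine ⟨g, SW.mem_closure_aOrbit hg, (SW.det_of_mem_closure_orbit hg).trans hx, σ, k, ns, hsum,
    fun i => g.submatrix (fun a => σ (SW.blockEmb ns hsum i a))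
      fun a => σ (SW.blockEmb ns hsum i a),
    hk, hns, fun i => (hG i).1, ⟨fun i a b => rfl, fun i j a b hij => htri _ _ ?_⟩,
    fun i => (hG i).2.hasBoundedAOrbit⟩
  rw [hlevel, hlevel]
  exact ho hij
end
end
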